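/- arXiv:math/0612643 — 2 statements merged into one kernel-verified Lean document; each statement's English description precedes it below -/
import Mathlib

section
/- Let (a,b,c,d) ∈ P. Let 𝒟 = {f ∈ ℒ² : Lf ∈ ℒ², the four limits f(0±) = lim_{k→∞} f(z±q^k) and f'(0±) = lim_{k→∞} (D_q f)(z±q^k) exist, f(0⁻) = f(0⁺) and f'(0⁻) = f'(0⁺)}. Then 𝒟 is dense in ℒ², and the densely defined unbounded operator L with domain 𝒟 on the Hilbert space ℒ² is self-adjoint: its adjoint has domain exactly 𝒟 and coincides with L there. -/
open Complex Filter

noncomputable section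

namespace VVBQJ

/-- The infinite q-shifted factorial `(x;q)_∞`. -/
def poch (q x : ℂ) : ℂ := ∏' j : ℕ, (1 - x * q ^ j)

/-- The q-shifted factorial `(x;q)_n`, `n ∈ ℕ`. -/
def pochN (q x : ℂ) (n : ℕ) : ℂ := ∏ j ∈ Finset.range n, (1 - x * q ^ j)

/-- The normalized Jacobi theta function `θ(x) = (x;q)_∞ (q/x;q)_∞`. -/
def theta (q x : ℂ) : ℂ := poch q x * poch q (q / x)

/-- The condition on the pairs `(a,b)` and `(c,d)` in the parameter set `P`. -/
def pairCond (q zm zp : ℝ) (α β : ℂ) : Prop :=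
  α = (starRingEnd ℂ) β ∨
    (∃ (A B : ℝ) (k₀ : ℤ), α = (A : ℂ) ∧ β = (B : ℂ) ∧
      zp * q ^ k₀ < 1 / B ∧ 1 / B < 1 / A ∧ 1 / A < zp * q ^ (k₀ - 1)) ∨
    (∃ (A B : ℝ) (k₀ : ℤ), α = (A : ℂ) ∧ β = (B : ℂ) ∧
      zm * q ^ (k₀ - 1) < 1 / A ∧ 1 / A < 1 / B ∧ 1 / B < zm * q ^ k₀)

/-- The parameter domain `P`. -/
def memP (q zm zp : ℝ) (a b c d : ℂ) : Prop :=
  a ≠ 0 ∧ b ≠ 0 ∧ c ≠ 0 ∧ d ≠ 0 ∧ a ≠ b ∧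
    (∀ x ∈ ({a, b, c, d} : Set ℂ), ∀ k : ℤ,
      x ≠ ((zp : ℂ))⁻¹ * (q : ℂ) ^ k ∧ x ≠ ((zm : ℂ))⁻¹ * (q : ℂ) ^ k) ∧
    pairCond q zm zp a b ∧ pairCond q zm zp c d

/-- The generic parameter domain `P_gen`. -/
def memPgen (q zm zp : ℝ) (a b c d : ℂ) : Prop :=
  memP q zm zp a b c d ∧ c ≠ d ∧
    ∀ k : ℤ, c / a ≠ (q : ℂ) ^ k ∧ c / b ≠ (q : ℂ) ^ k ∧ d / a ≠ (q : ℂ) ^ k ∧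
      d / b ≠ (q : ℂ) ^ k ∧ c * d / (a * b) ≠ (q : ℂ) ^ k

/-- `s = √(cdq/(ab))`, with the principal branch of the square root. -/
def sP (q : ℝ) (a b c d : ℂ) : ℂ := (c * d * (q : ℂ) / (a * b)) ^ ((1 : ℂ) / 2)

def Acoef (q : ℝ) (a b c d : ℂ) (x : ℝ) : ℂ :=
  (sP q a b c d)⁻¹ * (1 - (q : ℂ) / (a * (x : ℂ))) * (1 - (q : ℂ) / (b * (x : ℂ)))

def Bcoef (q : ℝ) (a b c d : ℂ) (x : ℝ) : ℂ :=
  sP q a b c d * (1 - 1 / (c * (x : ℂ))) * (1 - 1 / (d * (x : ℂ)))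

def Ccoef (q : ℝ) (a b c d : ℂ) (x : ℝ) : ℂ :=
  sP q a b c d + (sP q a b c d)⁻¹ - Acoef q a b c d x - Bcoef q a b c d x

/-- The second order q-difference operator `L`. -/
def Lop (q : ℝ) (a b c d : ℂ) (f : ℝ → ℂ) (x : ℝ) : ℂ :=
  Acoef q a b c d x * f (x / q) + Bcoef q a b c d x * f (q * x) + Ccoef q a b c d x * f x

/-- The weight function `w`. -/
def w (q : ℝ) (a b c d : ℂ) (x : ℝ) : ℂ :=
  poch q (a * (x : ℂ)) * poch q (b * (x : ℂ)) / (poch q (c * (x : ℂ)) * poch q (d * (x : ℂ)))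

/-- The function `u(x) = (1-q)² B(x) x² w(x)`. -/
def u (q : ℝ) (a b c d : ℂ) (x : ℝ) : ℂ :=
  (1 - (q : ℂ)) ^ 2 * Bcoef q a b c d x * (x : ℂ) ^ 2 * w q a b c d x

/-- The Casorati determinant `D(f,g)`. -/
def casD (q : ℝ) (a b c d : ℂ) (f g : ℝ → ℂ) (x : ℝ) : ℂ :=
  (f x * g (q * x) - f (q * x) * g x) * u q a b c d x / ((1 - (q : ℂ)) * (x : ℂ))

/-- The truncated inner product `⟨f,g⟩_{k,l;m,n}`. -/
def trunc (q zm zp : ℝ) (a b c d : ℂ) (f g : ℝ → ℂ) (k l m n : ℤ) : ℂ :=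
  (1 - (q : ℂ)) *
    ((∑ j ∈ Finset.Icc n m, f (zp * q ^ j) * (starRingEnd ℂ) (g (zp * q ^ j)) *
        w q a b c d (zp * q ^ j) * ((zp * q ^ j : ℝ) : ℂ)) -
      ∑ j ∈ Finset.Icc k l, f (zm * q ^ j) * (starRingEnd ℂ) (g (zm * q ^ j)) *
        w q a b c d (zm * q ^ j) * ((zm * q ^ j : ℝ) : ℂ))

/-- The constant `K_z`. -/
def Kz (q : ℝ) (a b c d : ℂ) (z : ℝ) : ℂ :=
  (z : ℂ) * (1 - (q : ℂ)) * (theta q (a * z) * theta q (b * z)) /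
    (theta q (c * z) * theta q (d * z))

/-- Membership in the Hilbert space `ℒ²(ℝ_q, w(x) d_q x)`. -/
def memL2 (q zm zp : ℝ) (a b c d : ℂ) (f : ℝ → ℂ) : Prop :=
  Summable (fun k : ℤ => ‖f (zp * q ^ k)‖ ^ 2 * ‖w q a b c d (zp * q ^ k)‖ * |zp * q ^ k|) ∧
    Summable (fun k : ℤ => ‖f (zm * q ^ k)‖ ^ 2 * ‖w q a b c d (zm * q ^ k)‖ * |zm * q ^ k|)

/-- The inner product on `ℒ²`. -/
def innerL2 (q zm zp : ℝ) (a b c d : ℂ) (f g : ℝ → ℂ) : ℂ :=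
  (1 - (q : ℂ)) *
    ((∑' k : ℤ, f (zp * q ^ k) * (starRingEnd ℂ) (g (zp * q ^ k)) *
        w q a b c d (zp * q ^ k) * ((zp * q ^ k : ℝ) : ℂ)) -
      ∑' k : ℤ, f (zm * q ^ k) * (starRingEnd ℂ) (g (zm * q ^ k)) *
        w q a b c d (zm * q ^ k) * ((zm * q ^ k : ℝ) : ℂ))

/-- The squared `ℒ²`-norm. -/
def normSqL2 (q zm zp : ℝ) (a b c d : ℂ) (f : ℝ → ℂ) : ℝ :=
  (1 - q) *
    ((∑' k : ℤ, ‖f (zp * q ^ k)‖ ^ 2 * ‖w q a b c d (zp * q ^ k)‖ * (zp * q ^ k)) +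
      ∑' k : ℤ, ‖f (zm * q ^ k)‖ ^ 2 * ‖w q a b c d (zm * q ^ k)‖ * (-(zm * q ^ k)))

/-- The q-difference operator `D_q`. -/
def Dq (q : ℝ) (f : ℝ → ℂ) (x : ℝ) : ℂ := (f x - f (q * x)) / ((1 - (q : ℂ)) * (x : ℂ))

/-- The q-line `ℝ_q`. -/
def Rq (q zm zp : ℝ) : Set ℝ := {x | ∃ k : ℤ, x = zm * q ^ k ∨ x = zp * q ^ k}

/-- Membership in the domain `𝒟`. -/
def memD (q zm zp : ℝ) (a b c d : ℂ) (f : ℝ → ℂ) : Prop :=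
  memL2 q zm zp a b c d f ∧ memL2 q zm zp a b c d (Lop q a b c d f) ∧
    (∃ v : ℂ, Tendsto (fun k : ℕ => f (zm * q ^ k)) atTop (nhds v) ∧
        Tendsto (fun k : ℕ => f (zp * q ^ k)) atTop (nhds v)) ∧
    (∃ v : ℂ, Tendsto (fun k : ℕ => Dq q f (zm * q ^ k)) atTop (nhds v) ∧
        Tendsto (fun k : ℕ => Dq q f (zp * q ^ k)) atTop (nhds v))

/-- Membership in the eigenspace `V_μ` (functions on `ℝ_q`). -/
def memV (q zm zp : ℝ) (a b c d : ℂ) (μ : ℂ) (f : ℝ → ℂ) : Prop :=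
  (∀ x ∈ Rq q zm zp, Lop q a b c d f x = μ * f x) ∧
    (∃ v : ℂ, Tendsto (fun k : ℕ => f (zm * q ^ k)) atTop (nhds v) ∧
        Tendsto (fun k : ℕ => f (zp * q ^ k)) atTop (nhds v)) ∧
    (∃ v : ℂ, Tendsto (fun k : ℕ => Dq q f (zm * q ^ k)) atTop (nhds v) ∧
        Tendsto (fun k : ℕ => Dq q f (zp * q ^ k)) atTop (nhds v))

/-- The set of regular spectral values `S_reg = ℂ* \ {± q^{k/2}}`. -/
def Sreg (q : ℝ) (γ : ℂ) : Prop :=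
  γ ≠ 0 ∧ ∀ k : ℤ, γ ≠ ((q ^ ((k : ℝ) / 2) : ℝ) : ℂ) ∧ γ ≠ -((q ^ ((k : ℝ) / 2) : ℝ) : ℂ)

/-- The big q-Jacobi function `φ_γ(x)`. -/
def phi (q : ℝ) (a b c d : ℂ) (γ x : ℂ) : ℂ :=
  ∑' n : ℕ,
    pochN q (q / (a * x)) n * pochN q (sP q a b c d * γ) n * pochN q (sP q a b c d / γ) n /
      (pochN q q n * pochN q (c * q / a) n * pochN q (d * q / a) n) * (b * x) ^ n

/-- The asymptotic solution `Φ_γ(z q^{-k})`, in index form. -/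
def PhiIdx (q : ℝ) (a b c d : ℂ) (γ : ℂ) (z : ℝ) (k : ℤ) : ℂ :=
  let s : ℂ := sP q a b c d
  let x : ℂ := (z : ℂ) * (q : ℂ) ^ (-k)
  (s * γ) ^ k *
    (poch q ((q : ℂ) / (b * x)) * poch q ((q : ℂ) ^ 2 * γ / (a * s * x)) /
      (poch q ((q : ℂ) / (c * x)) * poch q ((q : ℂ) / (d * x)))) *
    ∑' n : ℕ,
      pochN q ((q : ℂ) * γ / s) n * pochN q (c * q * γ / (s * a)) n *
          pochN q (d * q * γ / (s * a)) n /
        (pochN q q n * pochN q ((q : ℂ) ^ 2 * γ / (a * s * x)) n * pochN q ((q : ℂ) * γ ^ 2) n) *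
        ((q : ℂ) / (b * x)) ^ n

/-- Casorati determinant at `x = z q^{-k}` for index-form functions. -/
def casDIdx (q : ℝ) (a b c d : ℂ) (f g : ℤ → ℂ) (z : ℝ) (k : ℤ) : ℂ :=
  (f k * g (k - 1) - f (k - 1) * g k) * u q a b c d (z * q ^ (-k)) /
    ((1 - (q : ℂ)) * ((z * q ^ (-k) : ℝ) : ℂ))

/-- The c-function `c_z(γ)`. -/
def cz (q : ℝ) (a b c d : ℂ) (z : ℝ) (γ : ℂ) : ℂ :=
  let s : ℂ := sP q a b c d
  poch q (s / γ) * poch q (c * q / (a * s * γ)) * poch q (d * q / (a * s * γ)) *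
      theta q (b * s * z * γ) /
    (poch q (c * q / a) * poch q (d * q / a) * poch q (1 / γ ^ 2) * theta q (b * z))

/-- The expansion coefficient `d_z(γ)`. -/
def dz (q : ℝ) (a b c d : ℂ) (z : ℝ) (γ : ℂ) : ℂ :=
  let s : ℂ := sP q a b c d
  (poch q (c * q / a) * poch q (d * q / a) * theta q (b * z) /
      (theta q (a / b) * theta q (c * z) * theta q (d * z))) *
    (poch q (c * q * γ / (s * b)) * poch q (d * q * γ / (s * b)) *
        theta q (a * s * z / (q * γ)) /
      (poch q (q * γ ^ 2) * poch q (s / γ)))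

/-- The Casorati determinant `v(γ) = D(Φ_γ^+, Φ_γ^-)`. -/
def vFun (q zm zp : ℝ) (a b c d : ℂ) (γ : ℂ) : ℂ :=
  let s : ℂ := sP q a b c d;
  -((zp : ℂ) * (1 - (q : ℂ)) * theta q ((zm : ℂ) / zp) /
      (theta q (c * zm) * theta q (d * zm) * theta q (c * zp) * theta q (d * zp))) *
    (poch q (c * q * γ / (a * s)) * poch q (d * q * γ / (a * s)) * poch q (c * q * γ / (b * s)) *
        poch q (d * q * γ / (b * s)) * poch q (s * γ) * poch q (q * γ / s) *
        theta q (a * b * s * zm * zp / (q * γ)) /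
      (γ * (poch q (q * γ ^ 2)) ^ 2))

/-- The function `v₁(γ)` in the continuous part of the spectral measure. -/
def v1Fun (q zm zp : ℝ) (a b c d : ℂ) (γ : ℂ) : ℂ :=
  let s : ℂ := sP q a b c d
  ((poch q (c * q / a)) ^ 2 * (poch q (d * q / a)) ^ 2 * theta q (b * zp) * theta q (b * zm) /
      ((1 - (q : ℂ)) * a * b * (zm : ℂ) ^ 2 * (zp : ℂ) ^ 2 *
        (theta q ((zm : ℂ) / zp) * theta q ((zp : ℂ) / zm) * theta q (a / b) * theta q (b / a)))) *
    (poch q (γ ^ 2) * poch q (γ⁻¹ ^ 2) /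
      (poch q (s * γ) * poch q (s / γ) * poch q (c * q * γ / (a * s)) *
        poch q (c * q / (a * s * γ)) * poch q (d * q * γ / (a * s)) *
        poch q (d * q / (a * s * γ)) *
        (theta q (s * γ) * theta q (s / γ) * theta q (a * b * s * zm * zp * γ) *
          theta q (a * b * s * zm * zp / γ)))) *
    ((zm : ℂ) * (theta q (a * zp) * theta q (c * zp) * theta q (d * zp) * theta q (b * zm) *
          theta q (a * s * zm * γ) * theta q (a * s * zm / γ)) -
      (zp : ℂ) * (theta q (a * zm) * theta q (c * zm) * theta q (d * zm) * theta q (b * zp) *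
          theta q (a * s * zp * γ) * theta q (a * s * zp / γ)))

/-- The function `v₂(γ)` in the continuous part of the spectral measure. -/
def v2Fun (q zm zp : ℝ) (a b c d : ℂ) (γ : ℂ) : ℂ :=
  let s : ℂ := sP q a b c d
  (poch q (c * q / a) * poch q (d * q / a) * poch q (c * q / b) * poch q (d * q / b) *
      (theta q (a * zp) * theta q (a * zm) * theta q (b * zp) * theta q (b * zm) *
        theta q (c * d * zm * zp)) /
      (a * b * (zm : ℂ) ^ 2 * (zp : ℂ) * (1 - (q : ℂ)) *
        (theta q ((zp : ℂ) / zm) * theta q (a / b) * theta q (b / a)))) *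
    (poch q (γ ^ 2) * poch q (γ⁻¹ ^ 2) /
      (poch q (s * γ) * poch q (s / γ) *
        (theta q (s * γ) * theta q (s / γ) * theta q (a * b * s * zm * zp * γ) *
          theta q (a * b * s * zm * zp / γ))))

/-- The function `u₁(γ)`. -/
def u1Fun (q zm zp : ℝ) (a b c d : ℂ) (γ : ℂ) : ℂ :=
  Kz q a b c d zp * cz q a b c d zp γ * cz q a b c d zp γ⁻¹ -
    Kz q a b c d zm * cz q a b c d zm γ * cz q a b c d zm γ⁻¹

/-- The function `u₂(γ)`. -/
def u2Fun (q zm zp : ℝ) (a b c d : ℂ) (γ : ℂ) : ℂ :=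
  Kz q a b c d zp * cz q a b c d zp γ * cz q b a c d zp γ⁻¹ -
    Kz q a b c d zm * cz q a b c d zm γ * cz q b a c d zm γ⁻¹

/-- The big q-Jacobi polynomial `P_k(y; α, β, δ; q)`. -/
def bigqJacobiP (q : ℝ) (α β δ : ℂ) (k : ℕ) (y : ℂ) : ℂ :=
  ∑ j ∈ Finset.range (k + 1),
    pochN q (((q : ℂ) ^ k)⁻¹) j * pochN q (α * β * (q : ℂ) ^ (k + 1)) j * pochN q y j /
      (pochN q q j * pochN q (α * q) j * pochN q (δ * q) j) * (q : ℂ) ^ j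

/-- The three-term operator on `ℤ` with coefficients `al`, `be`, `ga`. -/
def jacobiOp (al be ga F : ℤ → ℂ) (k : ℤ) : ℂ :=
  al k * F (k - 1) + be k * F (k + 1) + ga k * F k

/-- The difference quotient of a sequence with respect to the grid `z q ^ k`. -/
def gridDq (q z : ℝ) (F : ℤ → ℂ) (k : ℤ) : ℂ :=
  (F k - F (k + 1)) / ((1 - (q : ℂ)) * ((z * q ^ k : ℝ) : ℂ))

/-- The restriction of a function to the grid `z q ^ ℤ`. -/
def grid (q z : ℝ) (f : ℝ → ℂ) (k : ℤ) : ℂ := f (z * q ^ k)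

/-- Square summability with respect to the weight `‖W‖`. -/
def seqL2 (W F : ℤ → ℂ) : Prop := Summable fun k => ‖F k‖ ^ 2 * ‖W k‖

/-- The weighted Casorati determinant of two sequences. -/
def seqCas (be W F G : ℤ → ℂ) (k : ℤ) : ℂ := be k * W k * (F k * G (k + 1) - F (k + 1) * G k)

/-- The properties of the coefficients of `L` on one half `z q ^ ℤ` of the `q`-line that the proof
of self-adjointness depends on. -/
structure JacobiSystem (q z : ℝ) (κ σ : ℂ) (al be ga W : ℤ → ℂ) : Prop where
  q_pos : 0 < q
  q_lt_one : q < 1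
  z_ne : z ≠ 0
  κ_ne : κ ≠ 0
  conj_al : ∀ k, (starRingEnd ℂ) (al k) = al k
  conj_be : ∀ k, (starRingEnd ℂ) (be k) = be k
  conj_ga : ∀ k, (starRingEnd ℂ) (ga k) = ga k
  W_ne : ∀ k, W k ≠ 0
  symm : ∀ k, be k * W k = al (k + 1) * W (k + 1)
  sum_eq : ∀ k, al k + be k + ga k = σ
  W_lim : Tendsto (fun n : ℕ => W n / (q : ℂ) ^ n) atTop (nhds z)
  be_lim : Tendsto (fun n : ℕ => be n * ((q : ℂ) ^ n) ^ 2) atTop (nhds (κ / (z : ℂ) ^ 2))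
  al_bdd : ∃ C, ∀ n : ℕ, ‖al (-n)‖ ≤ C
  be_bdd : ∃ C, ∀ n : ℕ, ‖be (-n)‖ ≤ C
  lin_bdd : ∃ C, ∀ n : ℕ, ‖(al n / q - be n) * (q : ℂ) ^ n‖ ≤ C

/-- `F` belongs to the maximal domain of the three-term operator, tends to `f₀` at `0`, and its
difference quotient tends to `f₁` there. -/
structure SeqDom (q z : ℝ) (al be ga W F : ℤ → ℂ) (f₀ f₁ : ℂ) : Prop where
  l2 : seqL2 W F
  op_l2 : seqL2 W (jacobiOp al be ga F)
  lim : Tendsto (fun n : ℕ => F n) atTop (nhds f₀)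
  dq_lim : Tendsto (fun n : ℕ => gridDq q z F n) atTop (nhds f₁)

section Sequences

variable {q z : ℝ} {κ σ : ℂ} {al be ga W : ℤ → ℂ}

theorem exists_norm_le_of_tendsto {u : ℕ → ℂ} {l : ℂ} (h : Tendsto u atTop (nhds l)) :
    ∃ C, ∀ n, ‖u n‖ ≤ C := by
  obtain ⟨C, hC⟩ := (Metric.isBounded_range_of_tendsto u h).exists_norm_le
  exact ⟨C, fun n => hC _ ⟨n, rfl⟩⟩

theorem seqL2.add {F G : ℤ → ℂ} (hF : seqL2 W F) (hG : seqL2 W G) :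
    seqL2 W (fun k => F k + G k) := by
  refine Summable.of_nonneg_of_le (fun k => by positivity) (fun k => ?_)
    ((Summable.add hF hG).mul_left 2)
  have h1 := norm_add_le (F k) (G k)
  have h2 : ‖F k + G k‖ ^ 2 ≤ 2 * (‖F k‖ ^ 2 + ‖G k‖ ^ 2) := by
    nlinarith [norm_nonneg (F k + G k), sq_nonneg (‖F k‖ - ‖G k‖)]
  nlinarith [norm_nonneg (W k)]

theorem seqL2.const_mul {F : ℤ → ℂ} (hF : seqL2 W F) (t : ℂ) : seqL2 W (fun k => t * F k) := by
  refine (Summable.mul_left (‖t‖ ^ 2) hF).congr fun k => ?_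
  rw [norm_mul]; ring

theorem seqL2.summable_mul {F G : ℤ → ℂ} (hF : seqL2 W F) (hG : seqL2 W G) :
    Summable fun k => F k * (starRingEnd ℂ) (G k) * W k := by
  refine Summable.of_norm_bounded (Summable.add hF hG) fun k => ?_
  rw [norm_mul, norm_mul, RCLike.norm_conj, ← add_mul]
  refine mul_le_mul_of_nonneg_right ?_ (norm_nonneg _)
  nlinarith [sq_nonneg (‖F k‖ - ‖G k‖), norm_nonneg (F k), norm_nonneg (G k),
    mul_nonneg (norm_nonneg (F k)) (norm_nonneg (G k))]

/-- Telescoping over `ℤ`. -/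
theorem tsum_int_sub_telescope {T : ℤ → ℂ} {l : ℂ} (hs : Summable fun k => T (k - 1) - T k)
    (hp : Tendsto (fun n : ℕ => T n) atTop (nhds l))
    (hm : Tendsto (fun n : ℕ => T (-n)) atTop (nhds 0)) :
    ∑' k, (T (k - 1) - T k) = -l := by
  have hs' : Summable (fun n : ℕ => T ((n : ℤ) - 1) - T n) ∧
      Summable (fun n : ℕ => T (-((n : ℤ) + 1) - 1) - T (-((n : ℤ) + 1))) := by
    refine ⟨hs.comp_injective (Nat.cast_injective (R := ℤ)), ?_⟩
    have hinj : Function.Injective fun n : ℕ => -((n : ℤ) + 1) := fun a b hab => by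
      simpa using hab
    exact hs.comp_injective hinj
  rw [tsum_of_nat_of_neg_add_one (f := fun k => T (k - 1) - T k) hs'.1 hs'.2]
  have h1 : ∀ n : ℕ, ∑ i ∈ Finset.range (n + 1), (T ((i : ℤ) - 1) - T i) = T (-1) - T n := by
    intro n
    induction n with
    | zero => simp
    | succ n ih =>
      rw [Finset.sum_range_succ, ih]
      push_cast
      rw [add_sub_cancel_right]
      ring
  have h2 : ∀ n : ℕ, ∑ i ∈ Finset.range n, (T (-((i : ℤ) + 1) - 1) - T (-((i : ℤ) + 1))) =
      T (-((n + 1 : ℕ) : ℤ)) - T (-1) := by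
    intro n
    induction n with
    | zero => simp
    | succ n ih =>
      rw [Finset.sum_range_succ, ih]
      push_cast
      rw [show -((n : ℤ) + 1) - 1 = -((n : ℤ) + 1 + 1) by ring]
      ring
  have e1 := tendsto_nhds_unique (hs'.1.hasSum.tendsto_sum_nat.comp (tendsto_add_atTop_nat 1))
    ((tendsto_const_nhds.sub hp).congr fun n => (h1 n).symm)
  have e2 := tendsto_nhds_unique hs'.2.hasSum.tendsto_sum_nat
    ((((tendsto_add_atTop_iff_nat 1).2 hm).sub tendsto_const_nhds).congr fun n => (h2 n).symm)
  rw [e1, e2]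
  ring

theorem tendsto_natCast_cofinite : Tendsto (fun n : ℕ => (n : ℤ)) atTop cofinite := by
  rw [← Nat.cofinite_eq_atTop]
  exact Nat.cast_injective.tendsto_cofinite

theorem tendsto_neg_natCast_cofinite : Tendsto (fun n : ℕ => -(n : ℤ)) atTop cofinite := by
  rw [← Nat.cofinite_eq_atTop]
  exact Function.Injective.tendsto_cofinite fun a b hab => by simpa using hab

theorem summable_of_eventually_cofinite_eq_zero {E : Type*} [AddCommMonoid E] [TopologicalSpace E]
    {F : ℤ → E} (hF : ∀ᶠ k in cofinite, F k = 0) : Summable F :=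
  summable_of_hasFiniteSupport (eventually_cofinite.1 hF)

theorem seqL2_of_eventually_cofinite {F : ℤ → ℂ} (hF : ∀ᶠ k in cofinite, F k = 0) : seqL2 W F :=
  summable_of_eventually_cofinite_eq_zero (hF.mono fun k hk => by simp [hk])

theorem eventually_jacobiOp_eq_zero (al be ga : ℤ → ℂ) {F : ℤ → ℂ}
    (hF : ∀ᶠ k in cofinite, F k = 0) : ∀ᶠ k in cofinite, jacobiOp al be ga F k = 0 := by
  filter_upwards [hF, (add_left_injective (1 : ℤ)).tendsto_cofinite.eventually hF,
    (sub_left_injective (b := (1 : ℤ))).tendsto_cofinite.eventually hF] with k h0 h1 h2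
  simp [jacobiOp, h0, h1, h2]

theorem seqDom_of_support {F : ℤ → ℂ}
    (hF : ∀ᶠ k in cofinite, F k = 0) : SeqDom q z al be ga W F 0 0 := by
  have hD : ∀ᶠ k in cofinite, gridDq q z F k = 0 := by
    filter_upwards [hF, (add_left_injective (1 : ℤ)).tendsto_cofinite.eventually hF] with k h0 h1
    simp [gridDq, h0, h1]
  exact ⟨seqL2_of_eventually_cofinite hF,
    seqL2_of_eventually_cofinite (eventually_jacobiOp_eq_zero al be ga hF),
    tendsto_nhds_of_eventually_eq (tendsto_natCast_cofinite.eventually hF),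
    tendsto_nhds_of_eventually_eq (tendsto_natCast_cofinite.eventually hD)⟩

namespace JacobiSystem

theorem cas_telescope (h : JacobiSystem q z κ σ al be ga W) (F G : ℤ → ℂ) (k : ℤ) :
    jacobiOp al be ga F k * (starRingEnd ℂ) (G k) * W k -
        F k * (starRingEnd ℂ) (jacobiOp al be ga G k) * W k =
      seqCas be W F (fun j => (starRingEnd ℂ) (G j)) (k - 1) -
        seqCas be W F (fun j => (starRingEnd ℂ) (G j)) k := by
  have hs := h.symm (k - 1)
  rw [sub_add_cancel] at hs
  simp only [seqCas, jacobiOp, map_add, map_mul, h.conj_al, h.conj_be, h.conj_ga, hs,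
    sub_add_cancel]
  ring

/-- Green's formula. -/
theorem green (h : JacobiSystem q z κ σ al be ga W) {F G : ℤ → ℂ} {l : ℂ}
    (h1 : Summable fun k => jacobiOp al be ga F k * (starRingEnd ℂ) (G k) * W k)
    (h2 : Summable fun k => F k * (starRingEnd ℂ) (jacobiOp al be ga G k) * W k)
    (hp : Tendsto (fun n : ℕ => seqCas be W F (fun j => (starRingEnd ℂ) (G j)) n) atTop (nhds l))
    (hm : Tendsto (fun n : ℕ => seqCas be W F (fun j => (starRingEnd ℂ) (G j)) (-n)) atTop
      (nhds 0)) :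
    ∑' k, jacobiOp al be ga F k * (starRingEnd ℂ) (G k) * W k -
      ∑' k, F k * (starRingEnd ℂ) (jacobiOp al be ga G k) * W k = -l := by
  rw [← h1.tsum_sub h2, ← tsum_int_sub_telescope ((h1.sub h2).congr fun k =>
    h.cas_telescope F G k) hp hm]
  exact tsum_congr fun k => h.cas_telescope F G k

/-- Green's formula against a finitely supported sequence. -/
theorem green_of_support (h : JacobiSystem q z κ σ al be ga W) {F : ℤ → ℂ}
    (hF : ∀ᶠ k in cofinite, F k = 0) (G : ℤ → ℂ) :
    ∑' k, jacobiOp al be ga F k * (starRingEnd ℂ) (G k) * W k =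
      ∑' k, F k * (starRingEnd ℂ) (jacobiOp al be ga G k) * W k := by
  have hop := eventually_jacobiOp_eq_zero al be ga hF
  have hcas : ∀ᶠ k in cofinite, seqCas be W F (fun j => (starRingEnd ℂ) (G j)) k = 0 := by
    filter_upwards [hF, (add_left_injective (1 : ℤ)).tendsto_cofinite.eventually hF] with k h0 h1
    simp [seqCas, h0, h1]
  have hz := h.green (F := F) (G := G) (l := 0)
    (summable_of_eventually_cofinite_eq_zero (hop.mono fun k hk => by simp [hk]))
    (summable_of_eventually_cofinite_eq_zero (hF.mono fun k hk => by simp [hk]))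
    (tendsto_nhds_of_eventually_eq (tendsto_natCast_cofinite.eventually hcas))
    (tendsto_nhds_of_eventually_eq (tendsto_neg_natCast_cofinite.eventually hcas))
  rwa [neg_zero, sub_eq_zero] at hz

/-- The point `∞` is a limit point: the Casorati determinant of square summable sequences
vanishes there. -/
theorem tendsto_cas_neg (h : JacobiSystem q z κ σ al be ga W) {F G : ℤ → ℂ} (hF : seqL2 W F)
    (hG : seqL2 W G) : Tendsto (fun n : ℕ => seqCas be W F G (-n)) atTop (nhds 0) := by
  obtain ⟨C₁, hC₁⟩ := h.al_bdd
  obtain ⟨C₂, hC₂⟩ := h.be_bdd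
  have hC₂0 : 0 ≤ C₂ := (norm_nonneg _).trans (hC₂ 0)
  have hC₁0 : 0 ≤ C₁ := (norm_nonneg _).trans (hC₁ 0)
  have e2 := tendsto_neg_natCast_cofinite
  have e1 : Tendsto (fun n : ℕ => -((n : ℤ) + 1)) atTop cofinite := by
    have := e2.comp (tendsto_add_atTop_nat 1)
    simpa only [Function.comp_def, Nat.cast_add, Nat.cast_one] using this
  have f1 := hF.tendsto_cofinite_zero.comp e1
  have f2 := hF.tendsto_cofinite_zero.comp e2
  have g1 := hG.tendsto_cofinite_zero.comp e1
  have g2 := hG.tendsto_cofinite_zero.comp e2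
  have hlim := ((f1.mul g2).add (f2.mul g1)).const_mul (2 * (C₂ * C₁))
  simp only [mul_zero, add_zero, Function.comp_def] at hlim
  rw [← tendsto_add_atTop_iff_nat 1, tendsto_zero_iff_norm_tendsto_zero]
  have hsq : Tendsto (fun n : ℕ => ‖seqCas be W F G (-((n + 1 : ℕ) : ℤ))‖ ^ 2) atTop (nhds 0) := by
    refine squeeze_zero (fun n => by positivity) (fun n => ?_) hlim
    have hP : ‖be (-((n : ℤ) + 1)) * W (-((n : ℤ) + 1))‖ ^ 2 ≤
        C₂ * C₁ * (‖W (-((n : ℤ) + 1))‖ * ‖W (-(n : ℤ))‖) := by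
      have hs := h.symm (-((n : ℤ) + 1))
      rw [show -((n : ℤ) + 1) + 1 = -(n : ℤ) by ring] at hs
      have hb := hC₂ (n + 1)
      push_cast at hb
      rw [sq]
      nth_rewrite 2 [hs]
      rw [norm_mul, norm_mul]
      calc _ = (‖be (-((n : ℤ) + 1))‖ * ‖al (-(n : ℤ))‖) *
            (‖W (-((n : ℤ) + 1))‖ * ‖W (-(n : ℤ))‖) := by ring
        _ ≤ _ := by
          have := hC₁ n
          gcongr
    simp only [seqCas]
    push_cast
    rw [show -((n : ℤ) + 1) + 1 = -(n : ℤ) by ring, norm_mul, mul_pow]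
    have hd : ‖F (-((n : ℤ) + 1)) * G (-(n : ℤ)) - F (-(n : ℤ)) * G (-((n : ℤ) + 1))‖ ^ 2 ≤
        2 * (‖F (-((n : ℤ) + 1))‖ ^ 2 * ‖G (-(n : ℤ))‖ ^ 2 +
          ‖F (-(n : ℤ))‖ ^ 2 * ‖G (-((n : ℤ) + 1))‖ ^ 2) := by
      have h1 := norm_sub_le (F (-((n : ℤ) + 1)) * G (-(n : ℤ)))
        (F (-(n : ℤ)) * G (-((n : ℤ) + 1)))
      have h2 := pow_le_pow_left₀ (norm_nonneg _) h1 2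
      simp only [norm_mul] at h2
      nlinarith [sq_nonneg (‖F (-((n : ℤ) + 1))‖ * ‖G (-(n : ℤ))‖ -
        ‖F (-(n : ℤ))‖ * ‖G (-((n : ℤ) + 1))‖)]
    refine (mul_le_mul hP hd (by positivity) (by positivity)).trans (le_of_eq ?_)
    ring
  have := hsq.sqrt
  simpa using this

theorem q_ne (h : JacobiSystem q z κ σ al be ga W) : (q : ℂ) ≠ 0 :=
  ofReal_ne_zero.2 h.q_pos.ne'

theorem one_sub_q_ne (h : JacobiSystem q z κ σ al be ga W) : 1 - (q : ℂ) ≠ 0 := by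
  rw [← ofReal_one, ← ofReal_sub]
  exact ofReal_ne_zero.2 (sub_pos.2 h.q_lt_one).ne'

theorem tendsto_q_pow (h : JacobiSystem q z κ σ al be ga W) :
    Tendsto (fun n : ℕ => (q : ℂ) ^ n) atTop (nhds 0) := by
  refine tendsto_pow_atTop_nhds_zero_of_norm_lt_one ?_
  rw [norm_real, Real.norm_of_nonneg h.q_pos.le]
  exact h.q_lt_one

theorem summable_q_pow (h : JacobiSystem q z κ σ al be ga W) : Summable fun n : ℕ => q ^ n :=
  summable_geometric_of_lt_one h.q_pos.le h.q_lt_one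

theorem summable_norm_W (h : JacobiSystem q z κ σ al be ga W) :
    Summable fun n : ℕ => ‖W n‖ := by
  obtain ⟨C, hC⟩ := exists_norm_le_of_tendsto h.W_lim
  refine Summable.of_nonneg_of_le (fun n => norm_nonneg _) (fun n => ?_) (h.summable_q_pow.mul_left C)
  have := hC n
  rwa [norm_div, norm_pow, norm_real, Real.norm_of_nonneg h.q_pos.le,
    div_le_iff₀ (pow_pos h.q_pos n)] at this

/-- A sequence that is bounded near `0` and vanishes near `∞` is square summable. -/
theorem seqL2_of_bounded (h : JacobiSystem q z κ σ al be ga W) {F : ℤ → ℂ}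
    (hp : ∃ C, ∀ᶠ n : ℕ in atTop, ‖F n‖ ≤ C) (hm : ∀ᶠ n : ℕ in atTop, F (-n) = 0) :
    seqL2 W F := by
  obtain ⟨C, hC⟩ := hp
  refine Summable.of_nat_of_neg ?_ ?_
  · refine Summable.of_norm_bounded_eventually_nat (h.summable_norm_W.mul_left (C ^ 2)) ?_
    filter_upwards [hC] with n hn
    rw [norm_mul, norm_pow, norm_norm, norm_norm]
    gcongr
  · refine summable_of_hasFiniteSupport (eventually_cofinite.1 ?_)
    rw [Nat.cofinite_eq_atTop]
    filter_upwards [hm] with n hn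
    simp [hn]

theorem tendsto_beW (h : JacobiSystem q z κ σ al be ga W) :
    Tendsto (fun n : ℕ => be n * W n * (z * (q : ℂ) ^ n)) atTop (nhds κ) := by
  have hz : (z : ℂ) ≠ 0 := ofReal_ne_zero.2 h.z_ne
  have := (h.be_lim.mul h.W_lim).mul_const (z : ℂ)
  have e : κ / (z : ℂ) ^ 2 * z * z = κ := by field_simp
  rw [e] at this
  refine this.congr fun n => ?_
  have := pow_ne_zero n h.q_ne
  field_simp

theorem sub_eq_gridDq (h : JacobiSystem q z κ σ al be ga W) (F : ℤ → ℂ) (n : ℕ) :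
    F n - F (n + 1) = gridDq q z F n * ((1 - q) * (z * (q : ℂ) ^ n)) := by
  have hz : (z : ℂ) ≠ 0 := ofReal_ne_zero.2 h.z_ne
  have := pow_ne_zero n h.q_ne
  have := h.one_sub_q_ne
  simp only [gridDq, zpow_natCast, ofReal_mul, ofReal_pow]
  field_simp

/-- The limit of the Casorati determinant at `0`. -/
theorem tendsto_cas (h : JacobiSystem q z κ σ al be ga W) {F G : ℤ → ℂ} {f₀ f₁ g₀ g₁ : ℂ}
    (hf₀ : Tendsto (fun n : ℕ => F n) atTop (nhds f₀))
    (hf₁ : Tendsto (fun n : ℕ => gridDq q z F n) atTop (nhds f₁))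
    (hg₀ : Tendsto (fun n : ℕ => G n) atTop (nhds g₀))
    (hg₁ : Tendsto (fun n : ℕ => gridDq q z G n) atTop (nhds g₁)) :
    Tendsto (fun n : ℕ => seqCas be W F G n) atTop (nhds (κ * (1 - q) * (f₁ * g₀ - f₀ * g₁))) := by
  refine ((h.tendsto_beW.mul_const (1 - (q : ℂ))).mul ((hf₁.mul hg₀).sub (hf₀.mul hg₁))).congr
    fun n => ?_
  have e1 := h.sub_eq_gridDq F n
  have e2 := h.sub_eq_gridDq G n
  have e : F n * G (n + 1) - F (n + 1) * G n =
      (F n - F (n + 1)) * G n - F n * (G n - G (n + 1)) := by ring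
  rw [seqCas, e, e1, e2]
  ring

/-- If `F` and its image are square summable then `F` and its difference quotient have limits
at `0`. -/
theorem exists_seqDom (h : JacobiSystem q z κ σ al be ga W) {F : ℤ → ℂ} (hF : seqL2 W F)
    (hLF : seqL2 W (jacobiOp al be ga F)) :
    ∃ f₀ f₁, SeqDom q z al be ga W F f₀ f₁ := by
  have hH : seqL2 W (fun k => jacobiOp al be ga F k + -σ * F k) := hLF.add (hF.const_mul (-σ))
  have hsum : Summable fun n : ℕ => W n * (jacobiOp al be ga F n + -σ * F n) := by
    refine Summable.of_norm_bounded
      (h.summable_norm_W.add (hH.comp_injective Nat.cast_injective)) fun n => ?_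
    simp only [Function.comp_apply, norm_mul]
    nlinarith [norm_nonneg (W n), sq_nonneg (‖jacobiOp al be ga F n + -σ * F n‖ - 1),
      mul_nonneg (norm_nonneg (W n)) (sq_nonneg (‖jacobiOp al be ga F n + -σ * F n‖ - 1)),
      mul_nonneg (norm_nonneg (W n)) (norm_nonneg (jacobiOp al be ga F n + -σ * F n))]
  have htel : ∀ n : ℕ, be (-1) * W (-1) * (F (-1) - F 0) -
      ∑ i ∈ Finset.range (n + 1), W i * (jacobiOp al be ga F i + -σ * F i) =
      be n * W n * (F n - F (n + 1)) := by
    have hstep : ∀ k : ℤ, be (k - 1) * W (k - 1) * (F (k - 1) - F k) -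
        W k * (jacobiOp al be ga F k + -σ * F k) = be k * W k * (F k - F (k + 1)) := by
      intro k
      have hs := h.symm (k - 1)
      rw [sub_add_cancel] at hs
      rw [hs, ← h.sum_eq k, jacobiOp]
      ring
    intro n
    induction n with
    | zero => simpa using hstep 0
    | succ n ih =>
      rw [Finset.sum_range_succ, ← sub_sub, ih]
      have := hstep (n + 1)
      rw [add_sub_cancel_right] at this
      exact_mod_cast this
  have hE := ((hsum.hasSum.tendsto_sum_nat.comp (tendsto_add_atTop_nat 1)).const_sub
    (be (-1) * W (-1) * (F (-1) - F 0))).congr htel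
  have hD : ∃ f₁, Tendsto (fun n : ℕ => gridDq q z F n) atTop (nhds f₁) := by
    have hden := h.tendsto_beW.mul_const (1 - (q : ℂ))
    have hne := mul_ne_zero h.κ_ne h.one_sub_q_ne
    refine ⟨_, (hE.div hden hne).congr' ?_⟩
    filter_upwards [hden.eventually_ne hne] with n hn
    rw [Pi.div_apply, h.sub_eq_gridDq F n, div_eq_iff hn]
    ring
  obtain ⟨f₁, hf₁⟩ := hD
  obtain ⟨C, hC⟩ := exists_norm_le_of_tendsto hf₁
  have hs : Summable fun n : ℕ => F n - F (n + 1) := by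
    refine Summable.of_norm_bounded (h.summable_q_pow.mul_left (C * (‖1 - (q : ℂ)‖ * ‖(z : ℂ)‖)))
      fun n => ?_
    rw [h.sub_eq_gridDq F n, norm_mul, norm_mul, norm_mul, norm_pow, norm_real q,
      Real.norm_of_nonneg h.q_pos.le, ← mul_assoc ‖1 - (q : ℂ)‖, ← mul_assoc]
    have := hC n
    have := h.q_pos
    gcongr
  refine ⟨_, f₁, hF, hLF, (hs.hasSum.tendsto_sum_nat.const_sub (F 0)).congr fun n => ?_, hf₁⟩
  have := Finset.sum_range_sub' (fun n : ℕ => F n) n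
  push_cast at this
  rw [this]
  ring

/-- The image of a sequence that is constant near `0` and vanishes near `∞`. -/
theorem seqL2_jacobiOp_const (h : JacobiSystem q z κ σ al be ga W) {F : ℤ → ℂ}
    (hp : ∀ n : ℕ, F n = 1) (hm : ∀ k < 0, F k = 0) : seqL2 W (jacobiOp al be ga F) := by
  refine h.seqL2_of_bounded ⟨‖σ‖, ?_⟩ ?_
  · filter_upwards [eventually_ge_atTop 1] with n hn
    obtain ⟨m, rfl⟩ := Nat.exists_eq_add_of_le' hn
    have h1 := hp m
    have h2 := hp (m + 1)
    have h3 := hp (m + 1 + 1)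
    push_cast at h2 h3 ⊢
    rw [jacobiOp, add_sub_cancel_right, h1, h2, h3, ← h.sum_eq (m + 1)]
    apply le_of_eq
    ring_nf
  · filter_upwards [eventually_ge_atTop 2] with n hn
    rw [jacobiOp, hm _ (by omega), hm _ (by omega), hm _ (by omega)]
    ring

/-- The image of a sequence that is linear near `0` and vanishes near `∞`. -/
theorem seqL2_jacobiOp_linear (h : JacobiSystem q z κ σ al be ga W) {F : ℤ → ℂ}
    (hp : ∀ n : ℕ, F n = z * (q : ℂ) ^ n) (hm : ∀ k < 0, F k = 0) :
    seqL2 W (jacobiOp al be ga F) := by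
  obtain ⟨C, hC⟩ := h.lin_bdd
  refine h.seqL2_of_bounded ⟨‖(z : ℂ) * (1 - q)‖ * C + ‖σ * z‖, ?_⟩ ?_
  · filter_upwards [eventually_ge_atTop 1] with n hn
    obtain ⟨m, rfl⟩ := Nat.exists_eq_add_of_le' hn
    have h1 := hp m
    have h2 := hp (m + 1)
    have h3 := hp (m + 1 + 1)
    have h4 := hC (m + 1)
    push_cast at h2 h3 h4 ⊢
    have hq := h.q_ne
    have e : jacobiOp al be ga F (m + 1) = z * (1 - q) *
        ((al (m + 1) / q - be (m + 1)) * (q : ℂ) ^ (m + 1)) + σ * z * (q : ℂ) ^ (m + 1) := by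
      rw [jacobiOp, add_sub_cancel_right, h1, h2, h3, ← h.sum_eq (m + 1)]
      field_simp
      ring
    rw [e]
    refine (norm_add_le _ _).trans (add_le_add ?_ ?_)
    · rw [norm_mul]
      gcongr
    · rw [norm_mul, norm_pow, norm_real, Real.norm_of_nonneg h.q_pos.le]
      exact mul_le_of_le_one_right (norm_nonneg _) (pow_le_one₀ h.q_pos.le h.q_lt_one.le)
  · filter_upwards [eventually_ge_atTop 2] with n hn
    rw [jacobiOp, hm _ (by omega), hm _ (by omega), hm _ (by omega)]
    ring

/-- Green's formula on the maximal domain. -/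
theorem green_seqDom (h : JacobiSystem q z κ σ al be ga W) {F G : ℤ → ℂ} {f₀ f₁ g₀ g₁ : ℂ}
    (hF : SeqDom q z al be ga W F f₀ f₁) (hG : SeqDom q z al be ga W G g₀ g₁) :
    ∑' k, jacobiOp al be ga F k * (starRingEnd ℂ) (G k) * W k -
        ∑' k, F k * (starRingEnd ℂ) (jacobiOp al be ga G k) * W k =
      -(κ * (1 - q) * (f₁ * (starRingEnd ℂ) g₀ - f₀ * (starRingEnd ℂ) g₁)) := by
  refine h.green (hF.op_l2.summable_mul hG.l2) (hF.l2.summable_mul hG.op_l2)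
    (h.tendsto_cas hF.lim hF.dq_lim ((continuous_conj.tendsto g₀).comp hG.lim) ?_)
    (h.tendsto_cas_neg hF.l2 (by simpa [seqL2] using hG.l2))
  refine ((continuous_conj.tendsto g₁).comp hG.dq_lim).congr fun n => ?_
  simp [gridDq]

theorem seqDom_const (h : JacobiSystem q z κ σ al be ga W) :
    SeqDom q z al be ga W (fun k => if 0 ≤ k then 1 else 0) 1 0 where
  l2 := h.seqL2_of_bounded ⟨1, Eventually.of_forall fun n => by simp⟩ <| by
    filter_upwards [eventually_ge_atTop 1] with n hn
    exact if_neg (by omega)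
  op_l2 := h.seqL2_jacobiOp_const (fun n => by simp) fun k hk => if_neg (by omega)
  lim := by simp
  dq_lim := by
    refine tendsto_const_nhds.congr fun n => ?_
    rw [gridDq, if_pos (by omega), if_pos (by omega), sub_self, zero_div]

theorem seqDom_linear (h : JacobiSystem q z κ σ al be ga W) :
    SeqDom q z al be ga W (fun k => if 0 ≤ k then (z : ℂ) * (q : ℂ) ^ k else 0) 0 1 where
  l2 := by
    refine h.seqL2_of_bounded ?_ ?_
    · obtain ⟨C, hC⟩ := exists_norm_le_of_tendsto (h.tendsto_q_pow.const_mul (z : ℂ))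
      exact ⟨C, Eventually.of_forall fun n => by simpa using hC n⟩
    · filter_upwards [eventually_ge_atTop 1] with n hn
      exact if_neg (by omega)
  op_l2 := h.seqL2_jacobiOp_linear (fun n => by simp) fun k hk => if_neg (by omega)
  lim := by simpa using h.tendsto_q_pow.const_mul (z : ℂ)
  dq_lim := by
    refine tendsto_const_nhds.congr fun n => ?_
    have hz : (z : ℂ) ≠ 0 := ofReal_ne_zero.2 h.z_ne
    have hq := h.q_ne
    have := pow_ne_zero n h.q_ne
    have := h.one_sub_q_ne
    rw [gridDq, if_pos (by omega), if_pos (by omega), zpow_add₀ hq, zpow_one, zpow_natCast,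
      zpow_natCast, ofReal_mul, ofReal_pow]
    field_simp

end JacobiSystem
end Sequences

section Coefficients

variable {q z : ℝ} {a b c d : ℂ}

theorem summable_norm_poch (hq0 : 0 < q) (hq1 : q < 1) (x : ℂ) :
    Summable fun j : ℕ => ‖-(x * (q : ℂ) ^ j)‖ := by
  refine ((summable_geometric_of_lt_one hq0.le hq1).mul_left ‖x‖).congr fun j => ?_
  rw [norm_neg, norm_mul, norm_pow, norm_real, Real.norm_of_nonneg hq0.le]

theorem poch_ne_zero (hq0 : 0 < q) (hq1 : q < 1) {x : ℂ} (hx : ∀ j : ℕ, 1 - x * (q : ℂ) ^ j ≠ 0) :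
    poch q x ≠ 0 := by
  have := tprod_one_add_ne_zero_of_summable (f := fun j : ℕ => -(x * (q : ℂ) ^ j))
    (fun j => by simpa [sub_eq_add_neg] using hx j) (summable_norm_poch hq0 hq1 x)
  simpa [poch, sub_eq_add_neg] using this

theorem poch_eq_prod_mul (hq0 : 0 < q) (hq1 : q < 1) (x : ℂ) (n : ℕ) :
    poch q x = (∏ j ∈ Finset.range n, (1 - x * (q : ℂ) ^ j)) * poch q (x * (q : ℂ) ^ n) := by
  have hm : Multipliable fun j : ℕ => 1 - x * (q : ℂ) ^ (j + n) := by
    have := multipliable_one_add_of_summable (summable_norm_poch hq0 hq1 (x * (q : ℂ) ^ n))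
    refine this.congr fun j => ?_
    rw [← sub_eq_add_neg, mul_assoc, ← pow_add, add_comm n]
  rw [poch, ← Multipliable.prod_mul_tprod_nat_mul' (f := fun j : ℕ => 1 - x * (q : ℂ) ^ j) hm, poch]
  congr 1
  exact tprod_congr fun j => by rw [mul_assoc, ← pow_add, add_comm n]

theorem poch_eq_mul (hq0 : 0 < q) (hq1 : q < 1) (x : ℂ) :
    poch q x = (1 - x) * poch q (q * x) := by
  simpa [mul_comm x] using poch_eq_prod_mul hq0 hq1 x 1

theorem tendsto_poch (hq0 : 0 < q) (hq1 : q < 1) {x : ℂ}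
    (hx : ∀ j : ℕ, 1 - x * (q : ℂ) ^ j ≠ 0) :
    Tendsto (fun n : ℕ => poch q (x * (q : ℂ) ^ n)) atTop (nhds 1) := by
  have hm : Multipliable fun j : ℕ => 1 - x * (q : ℂ) ^ j := by
    refine (multipliable_one_add_of_summable (summable_norm_poch hq0 hq1 x)).congr fun j => ?_
    rw [← sub_eq_add_neg]
  have hne := poch_ne_zero hq0 hq1 hx
  have h := (tendsto_const_nhds (x := poch q x)).div hm.tendsto_prod_tprod_nat hne
  change Tendsto _ _ (nhds (poch q x / poch q x)) at h
  rw [div_self hne] at h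
  refine h.congr fun n => ?_
  rw [Pi.div_apply, div_eq_iff (Finset.prod_ne_zero_iff.2 fun j _ => hx j), mul_comm]
  exact poch_eq_prod_mul hq0 hq1 x n

theorem pairCond.exists_mul_eq {zm zp : ℝ} (hq0 : 0 < q) (hzm : zm < 0) (hzp : 0 < zp) {α β : ℂ}
    (h : pairCond q zm zp α β) (hα : α ≠ 0) : ∃ r : ℝ, 0 < r ∧ α * β = r := by
  rcases h with rfl | ⟨A, B, k, rfl, rfl, h1, h2, -⟩ | ⟨A, B, k, rfl, rfl, -, h2, h3⟩
  · refine ⟨normSq β, normSq_pos.2 fun h0 => hα (by simp [h0]), ?_⟩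
    rw [normSq_eq_conj_mul_self]
  · have hB : 0 < 1 / B := (mul_pos hzp (zpow_pos hq0 k)).trans h1
    exact ⟨A * B, mul_pos (one_div_pos.1 (hB.trans h2)) (one_div_pos.1 hB), by simp⟩
  · have hB : 1 / B < 0 := h3.trans (mul_neg_of_neg_of_pos hzm (zpow_pos hq0 k))
    exact ⟨A * B, mul_pos_of_neg_of_neg (one_div_neg.1 (h2.trans hB)) (one_div_neg.1 hB), by simp⟩

theorem pairCond.conj_eq {zm zp : ℝ} {α β : ℂ} (h : pairCond q zm zp α β) :
    (starRingEnd ℂ) α = β ∧ (starRingEnd ℂ) β = α ∨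
      (starRingEnd ℂ) α = α ∧ (starRingEnd ℂ) β = β := by
  rcases h with rfl | ⟨A, B, k, rfl, rfl, -⟩ | ⟨A, B, k, rfl, rfl, -⟩ <;> simp

theorem exists_sP_eq {r t : ℝ} (hq0 : 0 < q) (hr : 0 < r) (ht : 0 < t) (hab : a * b = r)
    (hcd : c * d = t) : ∃ s : ℝ, 0 < s ∧ sP q a b c d = s ∧ s ^ 2 * r = t * q := by
  have hpos : 0 < t * q / r := by positivity
  refine ⟨(t * q / r) ^ ((1 : ℝ) / 2), Real.rpow_pos_of_pos hpos _, ?_, ?_⟩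
  · rw [sP, hab, hcd, ofReal_cpow hpos.le]
    push_cast
    rfl
  · rw [← Real.sqrt_eq_rpow, Real.sq_sqrt hpos.le]
    field_simp

theorem w_mul (hq0 : 0 < q) (hq1 : q < 1) {x : ℝ}
    (hc : 1 - c * x ≠ 0) (hd : 1 - d * x ≠ 0) :
    w q a b c d x * ((1 - c * x) * (1 - d * x)) =
      w q a b c d (q * x) * ((1 - a * x) * (1 - b * x)) := by
  simp only [w, poch_eq_mul hq0 hq1 (_ * (x : ℂ)), ofReal_mul, mul_left_comm _ (q : ℂ)]
  generalize 1 - a * (x : ℂ) = α at *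
  generalize 1 - b * (x : ℂ) = β at *
  generalize 1 - c * (x : ℂ) = γ at *
  generalize 1 - d * (x : ℂ) = δ at *
  field_simp

theorem jacobiSystem_coef (hq0 : 0 < q) (hq1 : q < 1) (hz : z ≠ 0)
    (ha : a ≠ 0) (hb : b ≠ 0) (hc : c ≠ 0) (hd : d ≠ 0)
    (hne : ∀ x ∈ ({a, b, c, d} : Set ℂ), ∀ k : ℤ, x ≠ (z : ℂ)⁻¹ * (q : ℂ) ^ k)
    (hab : (starRingEnd ℂ) a = b ∧ (starRingEnd ℂ) b = a ∨
      (starRingEnd ℂ) a = a ∧ (starRingEnd ℂ) b = b)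
    (hcd : (starRingEnd ℂ) c = d ∧ (starRingEnd ℂ) d = c ∨
      (starRingEnd ℂ) c = c ∧ (starRingEnd ℂ) d = d)
    (hs0 : sP q a b c d ≠ 0) (hsc : (starRingEnd ℂ) (sP q a b c d) = sP q a b c d)
    (hs2 : sP q a b c d ^ 2 * (a * b) = c * d * q) :
    JacobiSystem q z (sP q a b c d / (c * d)) (sP q a b c d + (sP q a b c d)⁻¹)
      (grid q z (Acoef q a b c d)) (grid q z (Bcoef q a b c d)) (grid q z (Ccoef q a b c d))
      (grid q z fun x => w q a b c d x * x) := by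
  change JacobiSystem q z _ _ (fun k => Acoef q a b c d (z * q ^ k))
    (fun k => Bcoef q a b c d (z * q ^ k)) (fun k => Ccoef q a b c d (z * q ^ k))
    (fun k => w q a b c d (z * q ^ k) * ((z * q ^ k : ℝ) : ℂ))
  have hz' : (z : ℂ) ≠ 0 := ofReal_ne_zero.2 hz
  have hq' : (q : ℂ) ≠ 0 := ofReal_ne_zero.2 hq0.ne'
  have hx : ∀ x ∈ ({a, b, c, d} : Set ℂ), ∀ k : ℤ, 1 - x * ((z * q ^ k : ℝ) : ℂ) ≠ 0 := by
    intro x hx k h0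
    refine hne x hx (-k) ?_
    have := zpow_ne_zero k hq'
    push_cast at h0
    rw [zpow_neg]
    field_simp
    linear_combination -h0
  have hxn : ∀ x ∈ ({a, b, c, d} : Set ℂ), ∀ (k : ℤ) (j : ℕ),
      1 - x * ((z * q ^ k : ℝ) : ℂ) * (q : ℂ) ^ j ≠ 0 := by
    intro x hx' k j
    have := hx x hx' (k + j)
    rw [zpow_add₀ hq0.ne'] at this
    push_cast at this ⊢
    rw [zpow_natCast] at this
    convert this using 2
    ring
  have conjA : ∀ x : ℝ, (starRingEnd ℂ) (Acoef q a b c d x) = Acoef q a b c d x := by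
    intro x
    rcases hab with ⟨h1, h2⟩ | ⟨h1, h2⟩ <;>
      simp only [Acoef, map_mul, map_sub, map_div₀, map_inv₀, map_one, conj_ofReal, hsc, h1, h2]
    ring
  have conjB : ∀ x : ℝ, (starRingEnd ℂ) (Bcoef q a b c d x) = Bcoef q a b c d x := by
    intro x
    rcases hcd with ⟨h1, h2⟩ | ⟨h1, h2⟩ <;>
      simp only [Bcoef, map_mul, map_sub, map_div₀, map_one, conj_ofReal, hsc, h1, h2]
    ring
  have hqlim : Tendsto (fun n : ℕ => (q : ℂ) ^ n) atTop (nhds 0) := by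
    refine tendsto_pow_atTop_nhds_zero_of_norm_lt_one ?_
    rwa [norm_real, Real.norm_of_nonneg hq0.le]
  have bdd : ∀ φ : ℂ → ℂ, Continuous φ → ∃ C, ∀ n : ℕ, ‖φ ((q : ℂ) ^ n)‖ ≤ C := fun φ hφ =>
    exists_norm_le_of_tendsto ((hφ.tendsto 0).comp hqlim)
  refine
    { q_pos := hq0
      q_lt_one := hq1
      z_ne := hz
      κ_ne := div_ne_zero hs0 (mul_ne_zero hc hd)
      conj_al := fun k => conjA _
      conj_be := fun k => conjB _
      conj_ga := fun k => ?_
      W_ne := fun k => ?_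
      symm := fun k => ?_
      sum_eq := fun k => by rw [Ccoef]; ring
      W_lim := ?_
      be_lim := ?_
      al_bdd := ?_
      be_bdd := ?_
      lin_bdd := ?_ }
  · simp only [Ccoef, map_sub, map_add, map_inv₀, hsc, conjA, conjB]
  · refine mul_ne_zero ?_ (ofReal_ne_zero.2 (mul_ne_zero hz (zpow_ne_zero k hq0.ne')))
    exact div_ne_zero (mul_ne_zero (poch_ne_zero hq0 hq1 (hxn a (by simp) k))
      (poch_ne_zero hq0 hq1 (hxn b (by simp) k))) (mul_ne_zero
      (poch_ne_zero hq0 hq1 (hxn c (by simp) k)) (poch_ne_zero hq0 hq1 (hxn d (by simp) k)))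
  · have hw := w_mul (a := a) (b := b) hq0 hq1 (hx c (by simp) k) (hx d (by simp) k)
    have hqk : z * q ^ (k + 1) = q * (z * q ^ k) := by
      rw [zpow_add₀ hq0.ne', zpow_one]; ring
    have hxk : ((z * q ^ k : ℝ) : ℂ) ≠ 0 :=
      ofReal_ne_zero.2 (mul_ne_zero hz (zpow_ne_zero k hq0.ne'))
    rw [hqk]
    generalize z * q ^ k = x at *
    simp only [Acoef, Bcoef, ofReal_mul]
    generalize w q a b c d (q * x) = w₁ at *
    generalize w q a b c d x = w₀ at *
    generalize sP q a b c d = s at *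
    generalize (x : ℂ) = X at *
    have e1 : s * (1 - 1 / (c * X)) * (1 - 1 / (d * X)) * (w₀ * X) =
        s / (c * d * X) * (w₀ * ((1 - c * X) * (1 - d * X))) := by
      field_simp
      ring
    have e2 : s⁻¹ * (1 - q / (a * (q * X))) * (1 - q / (b * (q * X))) * (w₁ * (q * X)) =
        q / (s * (a * b) * X) * (w₁ * ((1 - a * X) * (1 - b * X))) := by
      field_simp
      ring
    have e3 : s / (c * d * X) = q / (s * (a * b) * X) := by
      rw [div_eq_div_iff (by simp [*]) (by simp [*])]
      linear_combination X * hs2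
    rw [e1, e2, e3, hw]
  · have hp : ∀ x ∈ ({a, b, c, d} : Set ℂ),
        Tendsto (fun n : ℕ => poch q (x * ((z * q ^ (n : ℤ) : ℝ) : ℂ))) atTop (nhds 1) := by
      intro x hx'
      refine (tendsto_poch hq0 hq1 (hxn x hx' 0)).congr fun n => ?_
      push_cast
      rw [zpow_zero, zpow_natCast, mul_one, mul_assoc]
    have := ((((hp a (by simp)).mul (hp b (by simp))).div ((hp c (by simp)).mul (hp d (by simp)))
      (by simp)).mul_const (z : ℂ))
    simp only [mul_one, div_one, one_mul] at this
    refine this.congr fun n => ?_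
    have hqn := pow_ne_zero n hq'
    simp only [w, Pi.div_apply]
    push_cast
    rw [zpow_natCast]
    field_simp
  · have hφ : Continuous fun t : ℂ => sP q a b c d * (t - 1 / (c * z)) * (t - 1 / (d * z)) := by
      fun_prop
    have := (hφ.tendsto 0).comp hqlim
    convert this using 1
    · funext n
      have hqn := pow_ne_zero n hq'
      simp only [Bcoef, Function.comp_apply]
      push_cast
      rw [zpow_natCast]
      field_simp
    · congr 1
      field_simp
      ring
  · obtain ⟨C, hC⟩ := bdd (fun t => (sP q a b c d)⁻¹ * (1 - q * t / (a * z)) *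
      (1 - q * t / (b * z))) (by fun_prop)
    refine ⟨C, fun n => (le_of_eq ?_).trans (hC n)⟩
    have hqn := pow_ne_zero n hq'
    simp only [Acoef]
    push_cast
    rw [zpow_neg, zpow_natCast]
    congr 1
    field_simp
  · obtain ⟨C, hC⟩ := bdd (fun t => sP q a b c d * (1 - t / (c * z)) * (1 - t / (d * z)))
      (by fun_prop)
    refine ⟨C, fun n => (le_of_eq ?_).trans (hC n)⟩
    have hqn := pow_ne_zero n hq'
    simp only [Bcoef]
    push_cast
    rw [zpow_neg, zpow_natCast]
    congr 1
    field_simp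
  · obtain ⟨C, hC⟩ := bdd (fun t => ((sP q a b c d)⁻¹ / q - sP q a b c d) * t -
      ((sP q a b c d)⁻¹ * (1 / a + 1 / b) - sP q a b c d * (1 / c + 1 / d)) / z) (by fun_prop)
    refine ⟨C, fun n => (le_of_eq ?_).trans (hC n)⟩
    have hqn := pow_ne_zero n hq'
    simp only [Acoef, Bcoef]
    push_cast
    rw [zpow_natCast]
    congr 1
    generalize sP q a b c d = s at *
    generalize (q : ℂ) ^ n = t at *
    have e3 : s / (c * d) = q / (s * (a * b)) := by
      rw [div_eq_div_iff (by simp [*]) (by simp [*])]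
      linear_combination hs2
    have e1 : (s⁻¹ * (1 - q / (a * (z * t))) * (1 - q / (b * (z * t))) / q) * t =
        s⁻¹ / q * t - s⁻¹ * (1 / a + 1 / b) / z + q / (s * (a * b)) / (z ^ 2 * t) := by
      field_simp
      ring
    have e2 : (s * (1 - 1 / (c * (z * t))) * (1 - 1 / (d * (z * t)))) * t =
        s * t - s * (1 / c + 1 / d) / z + s / (c * d) / (z ^ 2 * t) := by
      field_simp
      ring
    rw [sub_mul, e1, e2, e3]
    ring

end Coefficients

section Transfer

variable {q zm zp : ℝ} {a b c d : ℂ}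

theorem grid_Lop (hq : q ≠ 0) (z : ℝ) (f : ℝ → ℂ) :
    grid q z (Lop q a b c d f) = jacobiOp (grid q z (Acoef q a b c d))
      (grid q z (Bcoef q a b c d)) (grid q z (Ccoef q a b c d)) (grid q z f) := by
  funext k
  have h1 : z * q ^ k / q = z * q ^ (k - 1) := by rw [zpow_sub_one₀ hq]; ring
  have h2 : q * (z * q ^ k) = z * q ^ (k + 1) := by rw [zpow_add_one₀ hq]; ring
  simp only [grid, Lop, jacobiOp, h1, h2]

theorem Dq_grid (hq : q ≠ 0) (z : ℝ) (f : ℝ → ℂ) (n : ℕ) :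
    Dq q f (z * q ^ n) = gridDq q z (grid q z f) n := by
  have h2 : q * (z * q ^ n) = z * q ^ (n + 1 : ℤ) := by
    rw [zpow_add_one₀ hq, zpow_natCast]; ring
  simp only [Dq, gridDq, grid, h2, zpow_natCast]

theorem memL2_iff (f : ℝ → ℂ) : memL2 q zm zp a b c d f ↔
    seqL2 (grid q zp fun x => w q a b c d x * x) (grid q zp f) ∧
      seqL2 (grid q zm fun x => w q a b c d x * x) (grid q zm f) := by
  simp only [memL2, seqL2, grid, norm_mul, norm_real, Real.norm_eq_abs, abs_mul, mul_assoc]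

theorem innerL2_eq (f g : ℝ → ℂ) : innerL2 q zm zp a b c d f g = (1 - (q : ℂ)) *
    (∑' k, grid q zp f k * (starRingEnd ℂ) (grid q zp g k) *
        grid q zp (fun x => w q a b c d x * x) k -
      ∑' k, grid q zm f k * (starRingEnd ℂ) (grid q zm g k) *
        grid q zm (fun x => w q a b c d x * x) k) := by
  simp only [innerL2, grid, mul_assoc]

theorem memD_iff (hq : q ≠ 0) (f : ℝ → ℂ) : memD q zm zp a b c d f ↔ ∃ f₀ f₁,
    SeqDom q zp (grid q zp (Acoef q a b c d)) (grid q zp (Bcoef q a b c d))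
        (grid q zp (Ccoef q a b c d)) (grid q zp fun x => w q a b c d x * x) (grid q zp f) f₀ f₁ ∧
      SeqDom q zm (grid q zm (Acoef q a b c d)) (grid q zm (Bcoef q a b c d))
        (grid q zm (Ccoef q a b c d)) (grid q zm fun x => w q a b c d x * x)
        (grid q zm f) f₀ f₁ := by
  have hlim : ∀ z : ℝ, (fun k : ℕ => f (z * q ^ k)) = fun k : ℕ => grid q z f k := fun z => by
    funext k; rw [grid, zpow_natCast]
  simp only [memD, memL2_iff, grid_Lop hq, Dq_grid hq, hlim]
  constructor
  · rintro ⟨⟨h1, h2⟩, ⟨h3, h4⟩, ⟨f₀, h5, h6⟩, f₁, h7, h8⟩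
    exact ⟨f₀, f₁, ⟨h1, h3, h6, h8⟩, ⟨h2, h4, h5, h7⟩⟩
  · rintro ⟨f₀, f₁, ⟨h1, h3, h6, h8⟩, ⟨h2, h4, h5, h7⟩⟩
    exact ⟨⟨h1, h2⟩, ⟨h3, h4⟩, ⟨f₀, h5, h6⟩, f₁, h7, h8⟩

/-- A function on the `q`-line can be prescribed freely on both halves. -/
theorem exists_grid_eq (hq0 : 0 < q) (hq1 : q < 1) (hzm : zm < 0) (hzp : 0 < zp) (F G : ℤ → ℂ) :
    ∃ f : ℝ → ℂ, grid q zp f = F ∧ grid q zm f = G := by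
  have hinj : ∀ z : ℝ, z ≠ 0 → Function.Injective fun k : ℤ => z * q ^ k := fun z hz =>
    (mul_right_injective₀ hz).comp (zpow_right_injective₀ hq0 hq1.ne)
  refine ⟨Function.extend (fun k : ℤ => zp * q ^ k) F
    (Function.extend (fun k : ℤ => zm * q ^ k) G 0), ?_, ?_⟩
  · funext k
    exact (hinj zp hzp.ne').extend_apply _ _ k
  · funext k
    rw [grid, Function.extend_apply']
    · exact (hinj zm hzm.ne).extend_apply _ _ k
    · rintro ⟨j, hj⟩
      have h1 := mul_pos hzp (zpow_pos hq0 j)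
      have h2 := mul_neg_of_neg_of_pos hzm (zpow_pos hq0 k)
      linarith

theorem exists_jacobiSystem (hq0 : 0 < q) (hq1 : q < 1) (hzm : zm < 0) (hzp : 0 < zp)
    (hP : memP q zm zp a b c d) : ∃ κ σ,
      JacobiSystem q zp κ σ (grid q zp (Acoef q a b c d)) (grid q zp (Bcoef q a b c d))
        (grid q zp (Ccoef q a b c d)) (grid q zp fun x => w q a b c d x * x) ∧
      JacobiSystem q zm κ σ (grid q zm (Acoef q a b c d)) (grid q zm (Bcoef q a b c d))
        (grid q zm (Ccoef q a b c d)) (grid q zm fun x => w q a b c d x * x) := by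
  obtain ⟨ha, hb, hc, hd, -, hne, hab, hcd⟩ := hP
  obtain ⟨r, hr, hr'⟩ := hab.exists_mul_eq hq0 hzm hzp ha
  obtain ⟨t, ht, ht'⟩ := hcd.exists_mul_eq hq0 hzm hzp hc
  obtain ⟨s, hs, hs', hs2⟩ := exists_sP_eq hq0 hr ht hr' ht'
  have hs0 : sP q a b c d ≠ 0 := hs' ▸ ofReal_ne_zero.2 hs.ne'
  have hsc : (starRingEnd ℂ) (sP q a b c d) = sP q a b c d := by rw [hs', conj_ofReal]
  have hs2' : sP q a b c d ^ 2 * (a * b) = c * d * q := by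
    rw [hs', hr', ht']
    exact_mod_cast hs2
  exact ⟨_, _, jacobiSystem_coef hq0 hq1 hzp.ne' ha hb hc hd (fun x hx k => (hne x hx k).1)
      hab.conj_eq hcd.conj_eq hs0 hsc hs2',
    jacobiSystem_coef hq0 hq1 hzm.ne ha hb hc hd (fun x hx k => (hne x hx k).2)
      hab.conj_eq hcd.conj_eq hs0 hsc hs2'⟩

/-- The restrictions of a function to finite parts of the `q`-line approximate it in norm (for a
function of infinite norm this holds since divergent sums are zero by convention). -/
theorem exists_normSqL2_sub_lt (hq0 : 0 < q) (hq1 : q < 1) (hzm : zm < 0) (hzp : 0 < zp)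
    (f : ℝ → ℂ) {ε : ℝ} (hε : 0 < ε) : ∃ g : ℝ → ℂ,
      (∀ᶠ k in cofinite, grid q zp g k = 0) ∧ (∀ᶠ k in cofinite, grid q zm g k = 0) ∧
        normSqL2 q zm zp a b c d (fun x => f x - g x) < ε := by
  classical
  have htail : ∀ F : ℤ → ℝ, Tendsto (fun S : Finset ℤ => ∑' k, if k ∈ S then 0 else F k) atTop
      (nhds 0) := by
    intro F
    refine (tendsto_tsum_compl_atTop_zero F).congr fun S => ?_
    refine (tsum_subtype {k | k ∉ S} F).trans (tsum_congr fun k => ?_)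
    by_cases hk : k ∈ S <;> simp [hk]
  have hlim := ((htail fun k => ‖f (zp * q ^ k)‖ ^ 2 * ‖w q a b c d (zp * q ^ k)‖ *
    (zp * q ^ k)).add (htail fun k => ‖f (zm * q ^ k)‖ ^ 2 * ‖w q a b c d (zm * q ^ k)‖ *
    (-(zm * q ^ k)))).const_mul (1 - q)
  rw [add_zero, mul_zero] at hlim
  obtain ⟨S, hS⟩ := (hlim.eventually_lt_const hε).exists
  obtain ⟨g, hgp, hgm⟩ := exists_grid_eq hq0 hq1 hzm hzp
    (fun k => if k ∈ S then grid q zp f k else 0) (fun k => if k ∈ S then grid q zm f k else 0)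
  have hfin : ∀ F : ℤ → ℂ, ∀ᶠ k in cofinite, (if k ∈ S then F k else 0) = 0 := fun F =>
    S.eventually_cofinite_notMem.mono fun k hk => if_neg hk
  refine ⟨g, hgp ▸ hfin _, hgm ▸ hfin _, lt_of_eq_of_lt ?_ hS⟩
  rw [normSqL2]
  congr 2 <;>
  · refine tsum_congr fun k => ?_
    have h1 := congrFun hgp k
    have h2 := congrFun hgm k
    simp only [grid] at h1 h2
    simp only [h1, h2]
    split_ifs <;> simp

theorem innerL2_Lop_sub {κ σ : ℂ}
    (hp : JacobiSystem q zp κ σ (grid q zp (Acoef q a b c d)) (grid q zp (Bcoef q a b c d))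
        (grid q zp (Ccoef q a b c d)) (grid q zp fun x => w q a b c d x * x))
    (hm : JacobiSystem q zm κ σ (grid q zm (Acoef q a b c d)) (grid q zm (Bcoef q a b c d))
        (grid q zm (Ccoef q a b c d)) (grid q zm fun x => w q a b c d x * x))
    {f g : ℝ → ℂ} {f₀ f₁ g₀ g₁ g₀' g₁' : ℂ}
    (hfp : SeqDom q zp (grid q zp (Acoef q a b c d)) (grid q zp (Bcoef q a b c d))
        (grid q zp (Ccoef q a b c d)) (grid q zp fun x => w q a b c d x * x) (grid q zp f) f₀ f₁)
    (hfm : SeqDom q zm (grid q zm (Acoef q a b c d)) (grid q zm (Bcoef q a b c d))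
        (grid q zm (Ccoef q a b c d)) (grid q zm fun x => w q a b c d x * x) (grid q zm f) f₀ f₁)
    (hgp : SeqDom q zp (grid q zp (Acoef q a b c d)) (grid q zp (Bcoef q a b c d))
        (grid q zp (Ccoef q a b c d)) (grid q zp fun x => w q a b c d x * x) (grid q zp g) g₀ g₁)
    (hgm : SeqDom q zm (grid q zm (Acoef q a b c d)) (grid q zm (Bcoef q a b c d))
        (grid q zm (Ccoef q a b c d)) (grid q zm fun x => w q a b c d x * x)
        (grid q zm g) g₀' g₁') :
    innerL2 q zm zp a b c d (Lop q a b c d f) g - innerL2 q zm zp a b c d f (Lop q a b c d g) =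
      (1 - q) ^ 2 * κ * (f₀ * (starRingEnd ℂ) (g₁ - g₁') - f₁ * (starRingEnd ℂ) (g₀ - g₀')) := by
  have e1 := hp.green_seqDom hfp hgp
  have e2 := hm.green_seqDom hfm hgm
  simp only [innerL2_eq, grid_Lop hp.q_pos.ne', map_sub]
  linear_combination (1 - (q : ℂ)) * (e1 - e2)

theorem eq_Lop_of_innerL2_eq (hq0 : 0 < q) (hq1 : q < 1) (hzm : zm < 0) (hzp : 0 < zp)
    (hP : memP q zm zp a b c d) {g h : ℝ → ℂ}
    (hgh : ∀ f : ℝ → ℂ, memD q zm zp a b c d f →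
      innerL2 q zm zp a b c d (Lop q a b c d f) g = innerL2 q zm zp a b c d f h) :
    grid q zp h = grid q zp (Lop q a b c d g) ∧ grid q zm h = grid q zm (Lop q a b c d g) := by
  obtain ⟨κ, σ, hp, hm⟩ := exists_jacobiSystem hq0 hq1 hzm hzp hP
  have key : ∀ f : ℝ → ℂ, (∀ᶠ k in cofinite, grid q zp f k = 0) →
      (∀ᶠ k in cofinite, grid q zm f k = 0) →
      innerL2 q zm zp a b c d f (Lop q a b c d g) = innerL2 q zm zp a b c d f h := by
    intro f hfp hfm
    rw [← hgh f ((memD_iff hq0.ne' f).2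
      ⟨0, 0, seqDom_of_support hfp, seqDom_of_support hfm⟩)]
    simp only [innerL2_eq, grid_Lop hq0.ne', hp.green_of_support hfp, hm.green_of_support hfm]
  have hsing : ∀ (k : ℤ) , ∀ᶠ j in cofinite, (Pi.single k 1 : ℤ → ℂ) j = 0 := fun k =>
    (Set.finite_singleton k).eventually_cofinite_notMem.mono fun j hj =>
      Pi.single_eq_of_ne hj 1
  have htsum : ∀ (k : ℤ) (u v : ℤ → ℂ), ∑' j, (Pi.single k 1 : ℤ → ℂ) j * u j * v j =
      u k * v k := by
    intro k u v
    rw [tsum_eq_single k fun j hj => by simp [Pi.single_eq_of_ne hj], Pi.single_eq_same, one_mul]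
  have h1q := hp.one_sub_q_ne
  constructor <;> funext k
  · obtain ⟨f, hf1, hf2⟩ := exists_grid_eq hq0 hq1 hzm hzp (Pi.single k 1) 0
    have := key f (hf1 ▸ hsing k) (hf2 ▸ Eventually.of_forall fun _ => rfl)
    simp only [innerL2_eq, hf1, hf2, htsum, Pi.zero_apply, zero_mul, tsum_zero, sub_zero] at this
    exact ((starRingEnd ℂ).injective
      (mul_right_cancel₀ (hp.W_ne k) (mul_left_cancel₀ h1q this))).symm
  · obtain ⟨f, hf1, hf2⟩ := exists_grid_eq hq0 hq1 hzm hzp 0 (Pi.single k 1)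
    have := key f (hf1 ▸ Eventually.of_forall fun _ => rfl) (hf2 ▸ hsing k)
    simp only [innerL2_eq, hf1, hf2, htsum, Pi.zero_apply, zero_mul, tsum_zero, zero_sub] at this
    exact ((starRingEnd ℂ).injective
      (mul_right_cancel₀ (hm.W_ne k) (neg_injective (mul_left_cancel₀ h1q this)))).symm

end Transfer

/-- `𝒟` is dense in `ℒ²` and `(L, 𝒟)` is self-adjoint: `L` is symmetric
on `𝒟`, the domain of the adjoint is exactly `𝒟`, and the adjoint acts as `L` there. -/
theorem statement3 (q zm zp : ℝ) (a b c d : ℂ)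
    (hq0 : 0 < q) (hq1 : q < 1) (hzm : zm < 0) (hzp : 0 < zp)
    (hP : memP q zm zp a b c d) :
    (∀ f : ℝ → ℂ, memL2 q zm zp a b c d f → ∀ ε : ℝ, 0 < ε →
      ∃ g : ℝ → ℂ, memD q zm zp a b c d g ∧
        normSqL2 q zm zp a b c d (fun x => f x - g x) < ε) ∧
    (∀ f g : ℝ → ℂ, memD q zm zp a b c d f → memD q zm zp a b c d g →
      innerL2 q zm zp a b c d (Lop q a b c d f) g =
        innerL2 q zm zp a b c d f (Lop q a b c d g)) ∧
    (∀ g : ℝ → ℂ, memL2 q zm zp a b c d g →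
      ((∃ h : ℝ → ℂ, memL2 q zm zp a b c d h ∧ ∀ f : ℝ → ℂ, memD q zm zp a b c d f →
          innerL2 q zm zp a b c d (Lop q a b c d f) g = innerL2 q zm zp a b c d f h) ↔
        memD q zm zp a b c d g)) ∧
    (∀ g h : ℝ → ℂ, memD q zm zp a b c d g → memL2 q zm zp a b c d h →
      (∀ f : ℝ → ℂ, memD q zm zp a b c d f →
        innerL2 q zm zp a b c d (Lop q a b c d f) g = innerL2 q zm zp a b c d f h) →
      ∀ x ∈ Rq q zm zp, h x = Lop q a b c d g x) := by
  obtain ⟨κ, σ, hp, hm⟩ := exists_jacobiSystem hq0 hq1 hzm hzp hP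
  have hsymm : ∀ f g : ℝ → ℂ, memD q zm zp a b c d f → memD q zm zp a b c d g →
      innerL2 q zm zp a b c d (Lop q a b c d f) g =
        innerL2 q zm zp a b c d f (Lop q a b c d g) := by
    intro f g hf hg
    obtain ⟨f₀, f₁, hfp, hfm⟩ := (memD_iff hq0.ne' f).1 hf
    obtain ⟨g₀, g₁, hgp, hgm⟩ := (memD_iff hq0.ne' g).1 hg
    rw [← sub_eq_zero, innerL2_Lop_sub hp hm hfp hfm hgp hgm]
    simp
  refine ⟨fun f _ ε hε => ?_, hsymm, fun g hg => ⟨?_, fun hgD => ?_⟩, fun g h _ _ hgh x hx => ?_⟩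
  · obtain ⟨g, hgp, hgm, hlt⟩ := exists_normSqL2_sub_lt hq0 hq1 hzm hzp f hε
    exact ⟨g, (memD_iff hq0.ne' g).2 ⟨0, 0, seqDom_of_support hgp, seqDom_of_support hgm⟩,
      hlt⟩
  · rintro ⟨h, hh, hgh⟩
    obtain ⟨ep, em⟩ := eq_Lop_of_innerL2_eq hq0 hq1 hzm hzp hP hgh
    rw [memL2_iff, ep, em, grid_Lop hq0.ne', grid_Lop hq0.ne'] at hh
    obtain ⟨g₀, g₁, hgp⟩ := hp.exists_seqDom ((memL2_iff g).1 hg).1 hh.1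
    obtain ⟨g₀', g₁', hgm⟩ := hm.exists_seqDom ((memL2_iff g).1 hg).2 hh.2
    have hbd : ∀ (F G : ℤ → ℂ) (f₀ f₁ : ℂ),
        SeqDom q zp (grid q zp (Acoef q a b c d)) (grid q zp (Bcoef q a b c d))
          (grid q zp (Ccoef q a b c d)) (grid q zp fun x => w q a b c d x * x) F f₀ f₁ →
        SeqDom q zm (grid q zm (Acoef q a b c d)) (grid q zm (Bcoef q a b c d))
          (grid q zm (Ccoef q a b c d)) (grid q zm fun x => w q a b c d x * x) G f₀ f₁ →
        f₀ * (starRingEnd ℂ) (g₁ - g₁') - f₁ * (starRingEnd ℂ) (g₀ - g₀') = 0 := by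
      intro F G f₀ f₁ hF hG
      obtain ⟨f, rfl, rfl⟩ := exists_grid_eq hq0 hq1 hzm hzp F G
      have hinner : innerL2 q zm zp a b c d f h =
          innerL2 q zm zp a b c d f (Lop q a b c d g) := by
        simp only [innerL2_eq, ep, em]
      have := innerL2_Lop_sub hp hm hF hG hgp hgm
      rw [hgh f ((memD_iff hq0.ne' f).2 ⟨f₀, f₁, hF, hG⟩), hinner, sub_self] at this
      exact (mul_eq_zero.1 this.symm).resolve_left
        (mul_ne_zero (pow_ne_zero 2 hp.one_sub_q_ne) hp.κ_ne)
    have e1 := hbd _ _ 1 0 hp.seqDom_const hm.seqDom_const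
    have e0 := hbd _ _ 0 1 hp.seqDom_linear hm.seqDom_linear
    simp only [one_mul, zero_mul, sub_zero, zero_sub, neg_eq_zero, map_eq_zero, sub_eq_zero]
      at e0 e1
    subst e0 e1
    exact (memD_iff hq0.ne' g).2 ⟨_, _, hgp, hgm⟩
  · exact ⟨Lop q a b c d g, hgD.2.1, fun f hf => hsymm f g hf hgD⟩
  · obtain ⟨ep, em⟩ := eq_Lop_of_innerL2_eq hq0 hq1 hzm hzp hP hgh
    obtain ⟨k, rfl | rfl⟩ := hx
    · exact congrFun em k
    · exact congrFun ep k
end VVBQJ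
end
end

section
/- Let (a,b,c,d) ∈ P and μ ∈ ℂ. Then the complex vector spaces V_μ⁺ and V_μ⁻ both have dimension 2, and the complex vector space V_μ has dimension at most 2. -/
open Complex Filter

noncomputable section

namespace VVBQJ

/-- The q-derivative at `z q^k`, in index form. -/
def dqIdx (q z : ℝ) (F : ℤ → ℂ) (k : ℤ) : ℂ :=
  (F k - F (k + 1)) / ((1 - (q : ℂ)) * ((z * q ^ k : ℝ) : ℂ))

/-- The eigenspace `V_μ^±` of `L` on the half line `{z q^k}`, in index form. -/
def Veig (q : ℝ) (a b c d : ℂ) (z : ℝ) (μ : ℂ) : Submodule ℂ (ℤ → ℂ) where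
  carrier := {F | ∀ k : ℤ,
    Acoef q a b c d (z * q ^ k) * F (k - 1) + Bcoef q a b c d (z * q ^ k) * F (k + 1) +
      Ccoef q a b c d (z * q ^ k) * F k = μ * F k}
  add_mem' := by
    intro f g hf hg k
    have h1 := hf k
    have h2 := hg k
    simp only [Pi.add_apply]
    linear_combination h1 + h2
  zero_mem' := by
    intro k
    simp
  smul_mem' := by
    intro t f hf k
    have h := hf k
    simp only [Pi.smul_apply, smul_eq_mul]
    linear_combination t * h

/-- The eigenspace `V_μ` of `L` on `ℝ_q`, in index form: the first component is the
restriction to `ℝ_q⁻`, the second the restriction to `ℝ_q⁺`. -/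
def Vfull (q zm zp : ℝ) (a b c d : ℂ) (μ : ℂ) : Submodule ℂ ((ℤ → ℂ) × (ℤ → ℂ)) where
  carrier := {F |
    F.1 ∈ Veig q a b c d zm μ ∧ F.2 ∈ Veig q a b c d zp μ ∧
    (∃ v : ℂ, Tendsto (fun n : ℕ => F.1 n) atTop (nhds v) ∧
        Tendsto (fun n : ℕ => F.2 n) atTop (nhds v)) ∧
    (∃ v : ℂ, Tendsto (fun n : ℕ => dqIdx q zm F.1 n) atTop (nhds v) ∧
        Tendsto (fun n : ℕ => dqIdx q zp F.2 n) atTop (nhds v))}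
  add_mem' := by
    intro f g hf hg
    obtain ⟨hf1, hf2, ⟨v1, hv1, hv2⟩, ⟨v2, hw1, hw2⟩⟩ := hf
    obtain ⟨hg1, hg2, ⟨v1', hv1', hv2'⟩, ⟨v2', hw1', hw2'⟩⟩ := hg
    refine ⟨(Veig q a b c d zm μ).add_mem hf1 hg1, (Veig q a b c d zp μ).add_mem hf2 hg2,
      ⟨v1 + v1', ?_, ?_⟩, ⟨v2 + v2', ?_, ?_⟩⟩
    · exact hv1.add hv1'
    · exact hv2.add hv2'
    · have h : (fun n : ℕ => dqIdx q zm (f + g).1 n) =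
          fun n : ℕ => dqIdx q zm f.1 n + dqIdx q zm g.1 n := by
        funext n
        simp only [dqIdx, Prod.fst_add, Pi.add_apply]
        ring
      rw [h]
      exact hw1.add hw1'
    · have h : (fun n : ℕ => dqIdx q zp (f + g).2 n) =
          fun n : ℕ => dqIdx q zp f.2 n + dqIdx q zp g.2 n := by
        funext n
        simp only [dqIdx, Prod.snd_add, Pi.add_apply]
        ring
      rw [h]
      exact hw2.add hw2'
  zero_mem' := by
    refine ⟨(Veig q a b c d zm μ).zero_mem, (Veig q a b c d zp μ).zero_mem,
      ⟨0, ?_, ?_⟩, ⟨0, ?_, ?_⟩⟩ <;>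
    · simp only [Prod.fst_zero, Prod.snd_zero, Pi.zero_apply, dqIdx, sub_zero, sub_self,
        zero_div]
      exact tendsto_const_nhds
  smul_mem' := by
    intro t f hf
    obtain ⟨hf1, hf2, ⟨v1, hv1, hv2⟩, ⟨v2, hw1, hw2⟩⟩ := hf
    refine ⟨(Veig q a b c d zm μ).smul_mem t hf1, (Veig q a b c d zp μ).smul_mem t hf2,
      ⟨t * v1, ?_, ?_⟩, ⟨t * v2, ?_, ?_⟩⟩
    · exact hv1.const_mul t
    · exact hv2.const_mul t
    · have h : (fun n : ℕ => dqIdx q zm (t • f).1 n) =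
          fun n : ℕ => t * dqIdx q zm f.1 n := by
        funext n
        simp only [dqIdx, Prod.smul_fst, Pi.smul_apply, smul_eq_mul]
        ring
      rw [h]
      exact hw1.const_mul t
    · have h : (fun n : ℕ => dqIdx q zp (t • f).2 n) =
          fun n : ℕ => t * dqIdx q zp f.2 n := by
        funext n
        simp only [dqIdx, Prod.smul_snd, Pi.smul_apply, smul_eq_mul]
        ring
      rw [h]
      exact hw2.const_mul t

/-- Restriction of an element of `V_μ` to `ℝ_q⁺`. -/
def resPlus (q zm zp : ℝ) (a b c d : ℂ) (μ : ℂ) :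
    Vfull q zm zp a b c d μ →ₗ[ℂ] Veig q a b c d zp μ where
  toFun F := ⟨F.1.2, F.2.2.1⟩
  map_add' F G := rfl
  map_smul' t F := rfl

/-- Restriction of an element of `V_μ` to `ℝ_q⁻`. -/
def resMinus (q zm zp : ℝ) (a b c d : ℂ) (μ : ℂ) :
    Vfull q zm zp a b c d μ →ₗ[ℂ] Veig q a b c d zm μ where
  toFun F := ⟨F.1.1, F.2.1⟩
  map_add' F G := rfl
  map_smul' t F := rfl

section Recurrence

variable {p r t : ℤ → ℂ}

/-- A solution of a three-term recurrence with non-vanishing outer coefficients that vanishes at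
two neighbouring points is zero. -/
lemma eq_zero_of_recurrence (hp : ∀ k, p k ≠ 0) (hr : ∀ k, r k ≠ 0) {F : ℤ → ℂ}
    (hF : ∀ k, p k * F (k - 1) + r k * F (k + 1) + t k * F k = 0) {N : ℤ}
    (h0 : F N = 0) (h1 : F (N + 1) = 0) : F = 0 := by
  have key : ∀ k : ℤ, F k = 0 ∧ F (k + 1) = 0 := by
    intro k
    induction k using Int.inductionOn' (b := N) with
    | zero => exact ⟨h0, h1⟩
    | succ k _ ih =>
      refine ⟨ih.2, ?_⟩
      have h := hF (k + 1)
      rw [add_sub_cancel_right, ih.1, ih.2] at h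
      simpa [hr] using h
    | pred k _ ih =>
      rw [sub_add_cancel]
      refine ⟨?_, ih.1⟩
      have h := hF k
      rw [ih.1, ih.2] at h
      simpa [hp] using h
  funext k
  exact (key k).1

/-- The pairs `(F n, F (n + 1))` of the solution of the recurrence with initial values `v`. -/
def forwardPair (p r t : ℤ → ℂ) (v : ℂ × ℂ) : ℕ → ℂ × ℂ
  | 0 => v
  | n + 1 => ((forwardPair p r t v n).2,
      -(p (n + 1) * (forwardPair p r t v n).1 + t (n + 1) * (forwardPair p r t v n).2) / r (n + 1))

/-- The pairs `(F (-n), F (-n + 1))` of the solution of the recurrence with initial values `v`. -/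
def backwardPair (p r t : ℤ → ℂ) (v : ℂ × ℂ) : ℕ → ℂ × ℂ
  | 0 => v
  | n + 1 => (-(r (-n) * (backwardPair p r t v n).2 + t (-n) * (backwardPair p r t v n).1) / p (-n),
      (backwardPair p r t v n).1)

/-- The solution of the recurrence with initial values `v` at `0` and `1`. -/
def recurrenceSol (p r t : ℤ → ℂ) (v : ℂ × ℂ) : ℤ → ℂ
  | Int.ofNat n => (forwardPair p r t v n).1
  | Int.negSucc n => (backwardPair p r t v (n + 1)).1

lemma recurrenceSol_natCast (v : ℂ × ℂ) (n : ℕ) :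
    recurrenceSol p r t v n = (forwardPair p r t v n).1 := rfl

lemma recurrenceSol_neg_natCast (v : ℂ × ℂ) (n : ℕ) :
    recurrenceSol p r t v (-n) = (backwardPair p r t v n).1 := by
  cases n with
  | zero => rfl
  | succ n => rfl

lemma recurrenceSol_neg_natCast_add_one (v : ℂ × ℂ) (n : ℕ) :
    recurrenceSol p r t v (-n + 1) = (backwardPair p r t v n).2 := by
  cases n with
  | zero => rfl
  | succ n =>
    rw [show (-((n + 1 : ℕ) : ℤ) + 1) = -(n : ℤ) by push_cast; ring, recurrenceSol_neg_natCast]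
    rfl

lemma recurrenceSol_spec (hp : ∀ k, p k ≠ 0) (hr : ∀ k, r k ≠ 0) (v : ℂ × ℂ) (k : ℤ) :
    p k * recurrenceSol p r t v (k - 1) + r k * recurrenceSol p r t v (k + 1) +
      t k * recurrenceSol p r t v k = 0 := by
  have hcases : (∃ n : ℕ, k = n + 1) ∨ ∃ n : ℕ, k = -n := by
    rcases lt_or_ge 0 k with h | h
    · exact Or.inl ⟨(k - 1).toNat, by omega⟩
    · exact Or.inr ⟨(-k).toNat, by omega⟩
  rcases hcases with ⟨n, rfl⟩ | ⟨n, rfl⟩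
  · have e1 : recurrenceSol p r t v ((n : ℤ) + 1) = (forwardPair p r t v n).2 := rfl
    have e2 : recurrenceSol p r t v ((n : ℤ) + 1 + 1) =
      -(p (n + 1) * (forwardPair p r t v n).1 + t (n + 1) * (forwardPair p r t v n).2) /
        r (n + 1) := rfl
    rw [add_sub_cancel_right, recurrenceSol_natCast, e1, e2]
    field_simp [hr (n + 1)]
    ring
  · have e1 : recurrenceSol p r t v (-(n : ℤ) - 1) =
      -(r (-n) * (backwardPair p r t v n).2 + t (-n) * (backwardPair p r t v n).1) / p (-n) := by
      rw [show (-(n : ℤ) - 1) = -((n + 1 : ℕ) : ℤ) by push_cast; ring, recurrenceSol_neg_natCast]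
      rfl
    rw [e1, recurrenceSol_neg_natCast, recurrenceSol_neg_natCast_add_one]
    field_simp [hp (-n)]
    ring

/-- The solution space of a three-term recurrence with non-vanishing outer coefficients is
two-dimensional. -/
lemma rank_eq_two_of_recurrence (hp : ∀ k, p k ≠ 0) (hr : ∀ k, r k ≠ 0)
    (V : Submodule ℂ (ℤ → ℂ))
    (hV : ∀ F, F ∈ V ↔ ∀ k, p k * F (k - 1) + r k * F (k + 1) + t k * F k = 0) :
    Module.rank ℂ V = 2 := by
  let φ : V →ₗ[ℂ] ℂ × ℂ :=
    { toFun := fun F => (F.1 0, F.1 1)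
      map_add' := fun _ _ => rfl
      map_smul' := fun _ _ => rfl }
  have hφ : Function.Bijective φ := by
    constructor
    · rw [← LinearMap.ker_eq_bot, LinearMap.ker_eq_bot']
      intro F h
      have h' := Prod.ext_iff.1 h
      exact Subtype.ext
        (eq_zero_of_recurrence hp hr ((hV F.1).1 F.2) (N := 0) h'.1 h'.2)
    · intro v
      refine ⟨⟨recurrenceSol p r t v, (hV _).2 (recurrenceSol_spec hp hr v)⟩, rfl⟩
  rw [(LinearEquiv.ofBijective φ hφ).rank_eq, rank_prod', Module.rank_self]
  norm_num

end Recurrence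

/-- A sequence that tends to zero and decays no faster than a convergent product vanishes. -/
lemma eq_zero_of_le_one_add_mul {v ε : ℕ → ℝ} (hv : ∀ n, 0 ≤ v n)
    (hs : Summable ε) (h : ∀ n, v n ≤ (1 + ε n) * v (n + 1))
    (hlim : Tendsto v atTop (nhds 0)) (n : ℕ) : v n = 0 := by
  set P : ℕ → ℝ := fun n => Real.exp (∑ j ∈ Finset.range n, ε j) with hP
  have hmono : Monotone fun n => P n * v n := by
    refine monotone_nat_of_le_succ fun n => ?_
    have h1 : v n ≤ Real.exp (ε n) * v (n + 1) :=
      (h n).trans (mul_le_mul_of_nonneg_right (by linarith [Real.add_one_le_exp (ε n)]) (hv _))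
    calc P n * v n ≤ P n * (Real.exp (ε n) * v (n + 1)) :=
          mul_le_mul_of_nonneg_left h1 (Real.exp_pos _).le
      _ = P (n + 1) * v (n + 1) := by
          simp only [hP, Finset.sum_range_succ, Real.exp_add]
          ring
  have hPlim : Tendsto P atTop (nhds (Real.exp (∑' j, ε j))) :=
    (Real.continuous_exp.tendsto _).comp hs.hasSum.tendsto_sum_nat
  have hle := hmono.ge_of_tendsto (by simpa using hPlim.mul hlim) n
  exact le_antisymm (nonpos_of_mul_nonpos_right hle (Real.exp_pos _)) (hv n)

section Eigenspace

variable {q z : ℝ} {a b c d : ℂ}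

lemma sP_sq (ha : a ≠ 0) (hb : b ≠ 0) :
    sP q a b c d ^ 2 * (a * b) = c * d * q := by
  have h : sP q a b c d ^ 2 = c * d * q / (a * b) := by
    have := Complex.cpow_nat_inv_pow (c * d * (q : ℂ) / (a * b)) (n := 2) two_ne_zero
    rw [sP, one_div]
    exact_mod_cast this
  rw [h]
  field_simp

lemma sP_ne_zero (hq : q ≠ 0) (ha : a ≠ 0) (hb : b ≠ 0) (hc : c ≠ 0) (hd : d ≠ 0) :
    sP q a b c d ≠ 0 := by
  intro h
  have := sP_sq (q := q) (c := c) (d := d) ha hb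
  simp [h, hc, hd, hq] at this

/-- The parameter `α` avoids the pole lattice of the half line through `z`. -/
def avoids (q z : ℝ) (α : ℂ) : Prop := α ≠ 0 ∧ ∀ k : ℤ, α ≠ (z : ℂ)⁻¹ * (q : ℂ) ^ k

lemma avoids.one_sub_ne_zero {α : ℂ} (h : avoids q z α) (hq : q ≠ 0) (hz : z ≠ 0) (k : ℤ) :
    1 - 1 / (α * ((z * q ^ k : ℝ) : ℂ)) ≠ 0 := by
  have hqC : (q : ℂ) ≠ 0 := by exact_mod_cast hq
  have hzC : (z : ℂ) ≠ 0 := by exact_mod_cast hz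
  have hα := h.1
  intro h0
  apply h.2 (-k)
  push_cast at h0
  rw [zpow_neg]
  field_simp at h0 ⊢
  linear_combination h0

lemma avoids.one_sub_div_ne_zero {α : ℂ} (h : avoids q z α) (hq : q ≠ 0) (hz : z ≠ 0) (k : ℤ) :
    1 - (q : ℂ) / (α * ((z * q ^ k : ℝ) : ℂ)) ≠ 0 := by
  have hqC : (q : ℂ) ≠ 0 := by exact_mod_cast hq
  convert h.one_sub_ne_zero hq hz (k - 1) using 2
  push_cast
  rw [zpow_sub_one₀ hqC]
  field_simp

lemma Acoef_ne_zero (hq : q ≠ 0) (hz : z ≠ 0) (ha : avoids q z a) (hb : avoids q z b)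
    (hc : c ≠ 0) (hd : d ≠ 0) (k : ℤ) : Acoef q a b c d (z * q ^ k) ≠ 0 :=
  mul_ne_zero (mul_ne_zero (inv_ne_zero (sP_ne_zero hq ha.1 hb.1 hc hd))
    (ha.one_sub_div_ne_zero hq hz k)) (hb.one_sub_div_ne_zero hq hz k)

lemma Bcoef_ne_zero (hq : q ≠ 0) (hz : z ≠ 0) (ha : a ≠ 0) (hb : b ≠ 0)
    (hc : avoids q z c) (hd : avoids q z d) (k : ℤ) : Bcoef q a b c d (z * q ^ k) ≠ 0 :=
  mul_ne_zero (mul_ne_zero (sP_ne_zero hq ha hb hc.1 hd.1)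
    (hc.one_sub_ne_zero hq hz k)) (hd.one_sub_ne_zero hq hz k)

lemma mem_Veig_iff (μ : ℂ) (F : ℤ → ℂ) :
    F ∈ Veig q a b c d z μ ↔ ∀ k : ℤ, Acoef q a b c d (z * q ^ k) * F (k - 1) +
      Bcoef q a b c d (z * q ^ k) * F (k + 1) + (Ccoef q a b c d (z * q ^ k) - μ) * F k = 0 := by
  refine forall_congr' fun k => ?_
  rw [sub_mul, ← add_sub_assoc, sub_eq_zero]

lemma rank_Veig (hq : q ≠ 0) (hz : z ≠ 0) (ha : avoids q z a) (hb : avoids q z b)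
    (hc : avoids q z c) (hd : avoids q z d) (μ : ℂ) :
    Module.rank ℂ (Veig q a b c d z μ) = 2 :=
  rank_eq_two_of_recurrence (Acoef_ne_zero hq hz ha hb hc.1 hd.1)
    (Bcoef_ne_zero hq hz ha.1 hb.1 hc hd) _ (mem_Veig_iff μ)

/-- The backward first-order recurrence for the `q`-derivative of an eigenfunction. -/
lemma dqIdx_sub_one (hq : q ≠ 0) (hq1 : q ≠ 1) (hz : z ≠ 0) (ha : avoids q z a)
    (hb : avoids q z b) (hc : c ≠ 0) (hd : d ≠ 0) {μ : ℂ} {F : ℤ → ℂ}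
    (hF : F ∈ Veig q a b c d z μ) (k : ℤ) {x D : ℂ} (hx : x = ((z * q ^ k : ℝ) : ℂ))
    (hD : D = (1 - a * x / q) * (1 - b * x / q)) :
    dqIdx q z F (k - 1) =
      (1 + x * ((a / q + b / q - c - d + (c * d - a * b / q ^ 2) * x) / D)) * dqIdx q z F k +
      x * ((μ - sP q a b c d - (sP q a b c d)⁻¹) * sP q a b c d * (a * b) /
        (q * (1 - q)) / D) * F k := by
  have hqC : (q : ℂ) ≠ 0 := by exact_mod_cast hq
  have hq1C : (1 - q : ℂ) ≠ 0 := sub_ne_zero.2 (by exact_mod_cast hq1.symm)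
  have hxr : z * q ^ k ≠ 0 := mul_ne_zero hz (zpow_ne_zero _ hq)
  have hx0 : x ≠ 0 := by rw [hx]; exact_mod_cast hxr
  have haC := ha.1
  have hbC := hb.1
  have hs := sP_ne_zero hq haC hbC hc hd
  have hs2 := sP_sq (q := q) (c := c) (d := d) haC hbC
  have hfac : ∀ {α : ℂ}, avoids q z α → 1 - α * x / q ≠ 0 := by
    intro α hα h0
    apply hα.one_sub_div_ne_zero hq hz k
    have hαC := hα.1
    rw [← hx]
    field_simp at h0 ⊢
    linear_combination -h0
  have hD0 : D ≠ 0 := hD ▸ mul_ne_zero (hfac ha) (hfac hb)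
  have hA : Acoef q a b c d (z * q ^ k) * (sP q a b c d * (a * b) * x ^ 2) = q ^ 2 * D := by
    rw [Acoef, ← hx, hD]
    field_simp
    ring
  have hB : Bcoef q a b c d (z * q ^ k) * (sP q a b c d * (a * b) * x ^ 2) =
      q * ((1 - c * x) * (1 - d * x)) := by
    rw [Bcoef, ← hx]
    field_simp
    linear_combination (c * x - 1) * (d * x - 1) * hs2
  have hrec := hF k
  rw [Ccoef] at hrec
  have hx' : ((z * q ^ (k - 1) : ℝ) : ℂ) = x / q := by
    rw [hx]
    push_cast
    rw [zpow_sub_one₀ hqC]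
    ring
  have h1 : F (k - 1) = F k + (1 - q) * (x / q) * dqIdx q z F (k - 1) := by
    rw [dqIdx, hx', sub_add_cancel]
    field_simp
    ring
  have h2 : F (k + 1) = F k - (1 - q) * x * dqIdx q z F k := by
    rw [dqIdx, ← hx]
    field_simp
    ring
  rw [h1, h2] at hrec
  generalize dqIdx q z F (k - 1) = G' at *
  generalize dqIdx q z F k = G at *
  generalize sP q a b c d = s at *
  generalize Acoef q a b c d (z * q ^ k) = A at *
  generalize Bcoef q a b c d (z * q ^ k) = B at *
  have key : q * D * (1 - q) * G' = q * ((1 - c * x) * (1 - d * x)) * (1 - q) * G +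
      (μ - s - s⁻¹) * s * (a * b) * x * F k := by
    have : x * (q * D * (1 - q) * G') = x * (q * ((1 - c * x) * (1 - d * x)) * (1 - q) * G +
      (μ - s - s⁻¹) * s * (a * b) * x * F k) := by
      have e1 : x * (q * D * (1 - q) * G') = (q ^ 2 * D) * ((1 - q) * (x / q) * G') := by
        field_simp
      rw [e1, ← hA]
      linear_combination (s * (a * b) * x ^ 2) * hrec + (1 - q) * x * G * hB
    exact mul_left_cancel₀ hx0 this
  have key2 : D + x * (a / q + b / q - c - d + (c * d - a * b / q ^ 2) * x) =
      (1 - c * x) * (1 - d * x) := by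
    rw [hD]
    field_simp
    ring
  rw [← key2] at key
  generalize a / q + b / q - c - d + (c * d - a * b / q ^ 2) * x = E at *
  generalize (μ - s - s⁻¹) * s * (a * b) = K at *
  have hne : (q : ℂ) * D * (1 - q) ≠ 0 := mul_ne_zero (mul_ne_zero hqC hD0) hq1C
  apply mul_left_cancel₀ hne
  rw [key]
  field_simp

/-- An eigenfunction whose value and `q`-derivative tend to zero at the origin vanishes. -/
lemma eq_zero_of_mem_Veig (hq0 : 0 < q) (hq1 : q < 1) (hz : z ≠ 0) (ha : avoids q z a)
    (hb : avoids q z b) (hc : avoids q z c) (hd : avoids q z d) {μ : ℂ} {F : ℤ → ℂ}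
    (hF : F ∈ Veig q a b c d z μ) (h0 : Tendsto (fun n : ℕ => F n) atTop (nhds 0))
    (h1 : Tendsto (fun n : ℕ => dqIdx q z F n) atTop (nhds 0)) : F = 0 := by
  have hq := hq0.ne'
  have hqC : (q : ℂ) ≠ 0 := by exact_mod_cast hq
  let D : ℂ → ℂ := fun x => (1 - a * x / q) * (1 - b * x / q)
  let E₁ : ℂ → ℂ := fun x => (a / q + b / q - c - d + (c * d - a * b / q ^ 2) * x) / D x
  let E₂ : ℂ → ℂ := fun x => (μ - sP q a b c d - (sP q a b c d)⁻¹) * sP q a b c d * (a * b) /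
        (q * (1 - q)) / D x
  let x : ℕ → ℂ := fun n => ((z * q ^ (n : ℤ) : ℝ) : ℂ)
  have hDc : ContinuousAt D 0 := by fun_prop
  have hD0 : D 0 ≠ 0 := by simp [D]
  have hE₁ : ContinuousAt E₁ 0 := ContinuousAt.div (by fun_prop) hDc hD0
  have hE₂ : ContinuousAt E₂ 0 := ContinuousAt.div (by fun_prop) hDc hD0
  have hxn : ∀ n, ‖x n‖ = |z| * q ^ n := by
    intro n
    simp only [x, Complex.norm_real, Real.norm_eq_abs, abs_mul, zpow_natCast, abs_pow,
      abs_of_pos hq0]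
  have hx : Tendsto x atTop (nhds 0) := by
    rw [tendsto_zero_iff_norm_tendsto_zero]
    simp only [hxn]
    simpa using (tendsto_pow_atTop_nhds_zero_of_lt_one hq0.le hq1).const_mul |z|
  obtain ⟨C, hC0, N, hN⟩ : ∃ C : ℝ, 0 ≤ C ∧ ∃ N : ℕ, ∀ n ≥ N, ‖E₁ (x n)‖ ≤ C ∧ ‖E₂ (x n)‖ ≤ C := by
    refine ⟨max (‖E₁ 0‖ + 1) (‖E₂ 0‖ + 1), le_max_of_le_left (by positivity), ?_⟩
    rw [← eventually_atTop]
    filter_upwards [(hE₁.tendsto.comp hx).norm.eventually_lt_const (lt_add_one ‖E₁ 0‖),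
      (hE₂.tendsto.comp hx).norm.eventually_lt_const (lt_add_one ‖E₂ 0‖)] with n hn₁ hn₂
    exact ⟨le_max_of_le_left hn₁.le, le_max_of_le_right hn₂.le⟩
  let v : ℕ → ℝ := fun n => ‖F n‖ + ‖dqIdx q z F n‖
  let M : ℝ := C + ‖(1 - q : ℂ) / q‖ * (1 + C * |z|)
  have hM : 0 ≤ M := by positivity
  have hstep : ∀ n ≥ N, v n ≤ (1 + M * (|z| * q ^ (n + 1))) * v (n + 1) := by
    intro n hn
    obtain ⟨b₁, b₂⟩ := hN (n + 1) (by omega)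
    have hcast : ((n + 1 : ℕ) : ℤ) - 1 = n := by push_cast; ring
    have hG := dqIdx_sub_one hq hq1.ne hz ha hb hc.1 hd.1 hF ((n + 1 : ℕ) : ℤ) rfl rfl
    change _ = (1 + x (n + 1) * E₁ (x (n + 1))) * dqIdx q z F ((n + 1 : ℕ) : ℤ) +
      x (n + 1) * E₂ (x (n + 1)) * F ((n + 1 : ℕ) : ℤ) at hG
    rw [hcast] at hG
    have hxr : z * q ^ (n : ℤ) ≠ 0 := mul_ne_zero hz (zpow_ne_zero _ hq)
    have hq1C : (1 - q : ℂ) ≠ 0 := sub_ne_zero.2 (by exact_mod_cast hq1.ne')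
    have hFn : F n = F ((n + 1 : ℕ) : ℤ) + (1 - q) / q * x (n + 1) * dqIdx q z F n := by
      have hxs : x (n + 1) = ((z * q ^ (n : ℤ) : ℝ) : ℂ) * q := by
        simp only [x]
        push_cast
        rw [zpow_add_one₀ hqC]
        ring
      have hxC : ((z * q ^ (n : ℤ) : ℝ) : ℂ) ≠ 0 := by exact_mod_cast hxr
      rw [hxs, dqIdx, Nat.cast_succ]
      field_simp
      ring
    set y : ℝ := |z| * q ^ (n + 1) with hy
    have hy0 : 0 ≤ y := by positivity
    have hyz : y ≤ |z| := mul_le_of_le_one_right (abs_nonneg z) (pow_le_one₀ hq0.le hq1.le)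
    have hGn : ‖dqIdx q z F n‖ ≤ ‖dqIdx q z F ((n + 1 : ℕ) : ℤ)‖ + C * y * v (n + 1) := by
      have e₁ : ‖1 + x (n + 1) * E₁ (x (n + 1))‖ ≤ 1 + y * C := by
        refine (norm_add_le _ _).trans ?_
        rw [norm_one, norm_mul, hxn]
        gcongr
      have e₂ : ‖x (n + 1) * E₂ (x (n + 1))‖ ≤ y * C := by
        rw [norm_mul, hxn]
        gcongr
      rw [hG]
      refine (norm_add_le _ _).trans ?_
      rw [norm_mul, norm_mul]
      refine (add_le_add (mul_le_mul_of_nonneg_right e₁ (norm_nonneg _))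
        (mul_le_mul_of_nonneg_right e₂ (norm_nonneg _))).trans (le_of_eq ?_)
      simp only [v]
      ring
    have hv1 : ‖dqIdx q z F ((n + 1 : ℕ) : ℤ)‖ ≤ v (n + 1) := le_add_of_nonneg_left (norm_nonneg _)
    have hv0 : 0 ≤ v (n + 1) := (norm_nonneg _).trans hv1
    have hGn' : ‖dqIdx q z F n‖ ≤ (1 + C * |z|) * v (n + 1) := by
      have : C * y * v (n + 1) ≤ C * |z| * v (n + 1) := by gcongr
      linarith
    have hFn' : ‖F n‖ ≤ ‖F ((n + 1 : ℕ) : ℤ)‖ +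
        ‖(1 - q : ℂ) / q‖ * y * ((1 + C * |z|) * v (n + 1)) := by
      rw [hFn]
      refine (norm_add_le _ _).trans ?_
      rw [norm_mul, norm_mul, hxn]
      gcongr
    calc v n ≤ (‖F ((n + 1 : ℕ) : ℤ)‖ + ‖(1 - q : ℂ) / q‖ * y * ((1 + C * |z|) * v (n + 1))) +
          (‖dqIdx q z F ((n + 1 : ℕ) : ℤ)‖ + C * y * v (n + 1)) := add_le_add hFn' hGn
      _ = (1 + M * y) * v (n + 1) := by
          simp only [v, M]
          ring
  have hvlim : Tendsto v atTop (nhds 0) := by simpa using h0.norm.add h1.norm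
  have hsum : Summable fun n : ℕ => M * (|z| * q ^ (n + N + 1)) := by
    refine ((((summable_geometric_of_lt_one hq0.le hq1).mul_left |z|).mul_left M).comp_injective
      (i := fun n : ℕ => n + N + 1) fun m n h => ?_)
    simpa using h
  have hv : ∀ n, v (n + N) = 0 := by
    refine eq_zero_of_le_one_add_mul (fun n => by positivity) hsum
      (fun n => ?_) ((tendsto_add_atTop_iff_nat N).2 hvlim)
    rw [show n + 1 + N = n + N + 1 by ring]
    exact hstep (n + N) (by omega)
  have hF0 : ∀ n : ℕ, F ((n + N : ℕ) : ℤ) = 0 := fun n =>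
    norm_eq_zero.1 ((add_eq_zero_iff_of_nonneg (norm_nonneg _) (norm_nonneg _)).1 (hv n)).1
  refine eq_zero_of_recurrence (Acoef_ne_zero hq hz ha hb hc.1 hd.1)
    (Bcoef_ne_zero hq hz ha.1 hb.1 hc hd) ((mem_Veig_iff μ F).1 hF) (N := N) ?_ ?_
  · simpa using hF0 0
  · simpa [add_comm] using hF0 1

end Eigenspace

/-- `dim V_μ^± = 2` and `dim V_μ ≤ 2`. -/
theorem statement5 (q zm zp : ℝ) (a b c d : ℂ)
    (hq0 : 0 < q) (hq1 : q < 1) (hzm : zm < 0) (hzp : 0 < zp)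
    (hP : memP q zm zp a b c d) (μ : ℂ) :
    Module.rank ℂ (Veig q a b c d zp μ) = 2 ∧
    Module.rank ℂ (Veig q a b c d zm μ) = 2 ∧
    Module.rank ℂ (Vfull q zm zp a b c d μ) ≤ 2 := by
  obtain ⟨ha, hb, hc, hd, -, hpole, -, -⟩ := hP
  have havoid : ∀ z, z = zp ∨ z = zm →
      avoids q z a ∧ avoids q z b ∧ avoids q z c ∧ avoids q z d := by
    have hall : ∀ z, z = zp ∨ z = zm → ∀ α ∈ ({a, b, c, d} : Set ℂ), ∀ k : ℤ,
        α ≠ (z : ℂ)⁻¹ * (q : ℂ) ^ k := by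
      rintro z (rfl | rfl) α hα k
      · exact (hpole α hα k).1
      · exact (hpole α hα k).2
    intro z hz
    exact ⟨⟨ha, hall z hz a (by simp)⟩, ⟨hb, hall z hz b (by simp)⟩,
      ⟨hc, hall z hz c (by simp)⟩, ⟨hd, hall z hz d (by simp)⟩⟩
  obtain ⟨pa, pb, pc, pd⟩ := havoid zp (Or.inl rfl)
  obtain ⟨ma, mb, mc, md⟩ := havoid zm (Or.inr rfl)
  have hplus := rank_Veig hq0.ne' hzp.ne' pa pb pc pd μ
  refine ⟨hplus, rank_Veig hq0.ne' hzm.ne ma mb mc md μ, ?_⟩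
  rw [← hplus]
  refine LinearMap.rank_le_of_injective (resPlus q zm zp a b c d μ) ?_
  rw [← LinearMap.ker_eq_bot, LinearMap.ker_eq_bot']
  rintro ⟨⟨F, G⟩, hF, hG, ⟨v, hFv, hGv⟩, ⟨v', hFv', hGv'⟩⟩ h
  have hG0 : G = 0 := congrArg Subtype.val h
  subst hG0
  have hv : v = 0 := tendsto_nhds_unique hGv (by simp)
  have hv' : v' = 0 := tendsto_nhds_unique hGv' (by simp [dqIdx])
  subst hv hv'
  have hF0 : F = 0 := eq_zero_of_mem_Veig hq0 hq1 hzm.ne ma mb mc md hF hFv hFv'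
  subst hF0
  rfl
end VVBQJ
end
end
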